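/- Let G = (L, E) be a countable graph with no loops, isolated vertices, or multiple edges such that sup_{ℓ∈L} m_ℓ < ∞, where m_ℓ is the degree of ℓ. Then there exist λ > 0 and θ ∈ (0,1) such that for every probability measure Q on Ω = ∏_{⟨ℓ,ℓ'⟩∈E} Ω_{ℓℓ'} of product form Q = ⊗_{⟨ℓ,ℓ'⟩∈E} Q_{ℓℓ'} satisfying Q_{ℓℓ'}(‖v_{ℓℓ'}‖ > λ) < θ for every edge ⟨ℓ,ℓ'⟩, the set 𝒢(v) of Euclidean Gibbs measures is a singleton for Q-almost all v ∈ Ω. -/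

import Mathlib

open MeasureTheory

noncomputable section

/-- The loop space over `M`: continuous paths on `[0,1]` with equal endpoints,
with the supremum metric. -/
def Loop (M : Type*) [TopologicalSpace M] : Type _ :=
  {x : C(unitInterval, M) // x 0 = x 1}

variable {M : Type*} [MetricSpace M]

instance : MetricSpace (Loop M) :=
  inferInstanceAs (MetricSpace {x : C(unitInterval, M) // x 0 = x 1})

instance : MeasurableSpace (Loop M) := borel _

instance : BorelSpace (Loop M) := ⟨rfl⟩

/-- The underlying continuous path of a loop. -/
def Loop.path : Loop M → C(unitInterval, M) := Subtype.val

/-- `V(x,y) = ∫₀¹ v(x(τ), y(τ)) dτ`, the time-averaged pair interaction. -/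
def pathV (v : C(M × M, ℝ)) (x y : Loop M) : ℝ :=
  ∫ τ : unitInterval, v (x.path τ, y.path τ)

variable {L : Type*} [DecidableEq L] (G : SimpleGraph L) [DecidableRel G.Adj]
  [G.LocallyFinite] (χ : L → Measure (Loop M)) (v : L → L → C(M × M, ℝ))

/-- The configuration `x_Λ × y_{Λᶜ}`. -/
def Finset.glue (Λ : Finset L) (x : Λ → Loop M) (y : (ℓ : L) → Loop M) (ℓ : L) : Loop M :=
  if h : ℓ ∈ Λ then x ⟨ℓ, h⟩ else y ℓ

/-- The product measure `χ_Λ = ⊗_{ℓ ∈ Λ} χ_ℓ`. -/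
def chiProd (Λ : Finset L) : Measure (Λ → Loop M) :=
  Measure.pi fun ℓ : Λ => χ ℓ

/-- `V_Λ(x_Λ | y)`: interaction energy of `x_Λ` inside `Λ` plus its interaction with
the boundary condition `y` outside `Λ`.  (Each unordered interior edge is counted twice in
the double sum, whence the factor 1/2.) -/
def condV (Λ : Finset L) (x : Λ → Loop M) (y : (ℓ : L) → Loop M) : ℝ :=
  (1 / 2) * ∑ ℓ : Λ, ∑ ℓ' : Λ,
      (if G.Adj ℓ ℓ' then pathV (v ℓ ℓ') (x ℓ) (x ℓ') else 0)
    + ∑ ℓ : Λ, ∑ ℓ' ∈ G.neighborFinset (ℓ : L) \ Λ, pathV (v ℓ ℓ') (x ℓ) (y ℓ')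

/-- The local Gibbs kernel `π_Λ(dx | y)` as a measure on configuration space. -/
def gibbsKernel (Λ : Finset L) (y : (ℓ : L) → Loop M) : Measure ((ℓ : L) → Loop M) :=
  (∫⁻ x, ENNReal.ofReal (Real.exp (condV G v Λ x y)) ∂chiProd χ Λ)⁻¹ •
    Measure.map (fun x => Finset.glue Λ x y)
      ((chiProd χ Λ).withDensity fun x => ENNReal.ofReal (Real.exp (condV G v Λ x y)))

/-- `μ` is a Euclidean Gibbs measure: a probability measure satisfying the DLR equation
`μ(B) = ∫ π_Λ(B|x) μ(dx)` for every finite non-void `Λ`. -/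
def IsGibbs (μ : Measure ((ℓ : L) → Loop M)) : Prop :=
  IsProbabilityMeasure μ ∧
    ∀ Λ : Finset L, Λ.Nonempty → μ.bind (gibbsKernel G χ v Λ) = μ

end

noncomputable section

/-- The Banach space `Ω_{ℓℓ'}` of continuous symmetric functions on `M × M`
(with the supremum norm, inherited from `C(M × M, ℝ)`). -/
def SymPot (M : Type*) [TopologicalSpace M] : Type _ :=
  {f : C(M × M, ℝ) // ∀ ξ η : M, f (ξ, η) = f (η, ξ)}

variable {M : Type*} [MetricSpace M] [CompactSpace M]

instance : MetricSpace (SymPot M) :=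
  inferInstanceAs (MetricSpace {f : C(M × M, ℝ) // ∀ ξ η : M, f (ξ, η) = f (η, ξ)})

instance : MeasurableSpace (SymPot M) := borel _

/-- The underlying continuous function of an element of `SymPot M`. -/
def SymPot.val : SymPot M → C(M × M, ℝ) := Subtype.val

variable {L : Type*} (G : SimpleGraph L)

/-- Reconstruct from `ω ∈ Ω = ∏_{⟨ℓ,ℓ'⟩ ∈ E} Ω_{ℓℓ'}` the family of pair potentials. -/
def toPot [DecidableRel G.Adj] (ω : (e : G.edgeSet) → SymPot M) (ℓ ℓ' : L) : C(M × M, ℝ) :=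
  if h : G.Adj ℓ ℓ' then (ω ⟨s(ℓ, ℓ'), G.mem_edgeSet.mpr h⟩).val else 0

section Uniqueness

open Filter Topology Set
open scoped ENNReal

section Trails

variable {V : Type*} [DecidableEq V] (G : SimpleGraph V) [G.LocallyFinite]

open scoped Classical in
/-- The sum, over trails of length `n` from `w` to `Δ` that use only edges in `S`, of the product
of the weights `r e` of the edges of the trail. -/
def trailSum (r : Sym2 V → ℝ≥0∞) (Δ : Finset V) : ℕ → Set (Sym2 V) → V → ℝ≥0∞
  | 0, _, w => if w ∈ Δ then 1 else 0
  | n + 1, S, w => ∑ x ∈ G.neighborFinset w,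
      if s(w, x) ∈ S then r s(w, x) * trailSum r Δ n (S \ {s(w, x)}) x else 0

/-- The number of walks of length `n` from `w` to `Δ`. -/
def walkCount (Δ : Finset V) : ℕ → V → ℝ≥0∞
  | 0, w => if w ∈ Δ then 1 else 0
  | n + 1, w => ∑ x ∈ G.neighborFinset w, walkCount Δ n x

variable {G}

theorem trailSum_mono (r : Sym2 V → ℝ≥0∞) (Δ : Finset V) (n : ℕ) {S T : Set (Sym2 V)}
    (hST : S ⊆ T) (w : V) : trailSum G r Δ n S w ≤ trailSum G r Δ n T w := by
  induction n generalizing S T w with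
  | zero => exact le_rfl
  | succ n ih =>
    refine Finset.sum_le_sum fun x _ => ?_
    by_cases h : s(w, x) ∈ S
    · rw [if_pos h, if_pos (hST h)]
      gcongr
      exact ih (sdiff_subset_sdiff_left hST) x
    · simp [h]

theorem trailSum_remove_edge_add_le (r : Sym2 V → ℝ≥0∞) (Δ : Finset V) (n : ℕ)
    {S : Set (Sym2 V)} {w x : V} (hadj : G.Adj w x) (hS : s(w, x) ∈ S) :
    trailSum G r Δ (n + 1) (S \ {s(w, x)}) w + r s(w, x) * trailSum G r Δ n (S \ {s(w, x)}) x
      ≤ trailSum G r Δ (n + 1) S w := by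
  have hx : x ∈ G.neighborFinset w := by simpa using hadj
  simp only [trailSum]
  rw [← Finset.add_sum_erase _ _ hx, ← Finset.add_sum_erase _ _ hx, if_neg (by simp), zero_add,
    if_pos hS, add_comm]
  gcongr with v hv
  by_cases h : s(w, v) ∈ S \ {s(w, x)}
  · rw [if_pos h, if_pos h.1]
    gcongr
    exact trailSum_mono r Δ n (sdiff_subset_sdiff_left sdiff_subset) v
  · simp [h]

theorem tsum_trailSum_remove_edge_add_le (r : Sym2 V → ℝ≥0∞) (Δ : Finset V)
    {S : Set (Sym2 V)} {w x : V} (hadj : G.Adj w x) (hS : s(w, x) ∈ S) :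
    ∑' n, trailSum G r Δ n (S \ {s(w, x)}) w
        + r s(w, x) * ∑' n, trailSum G r Δ n (S \ {s(w, x)}) x
      ≤ ∑' n, trailSum G r Δ n S w := by
  rw [tsum_eq_zero_add' ENNReal.summable, tsum_eq_zero_add' (f := fun n => trailSum G r Δ n S w)
    ENNReal.summable, ← ENNReal.tsum_mul_left, add_assoc, ← ENNReal.tsum_add]
  exact add_le_add le_rfl
    (ENNReal.tsum_le_tsum fun n => trailSum_remove_edge_add_le r Δ n hadj hS)

theorem measurable_trailSum {Ω : Type*} [MeasurableSpace Ω] {R : Sym2 V → Ω → ℝ≥0∞}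
    (hR : ∀ e, Measurable (R e)) (Δ : Finset V) (n : ℕ) (S : Set (Sym2 V)) (w : V) :
    Measurable fun ω => trailSum G (fun e => R e ω) Δ n S w := by
  induction n generalizing S w with
  | zero => exact measurable_const
  | succ n ih =>
    simp only [trailSum]
    refine Finset.measurable_sum _ fun x _ => ?_
    split_ifs
    · exact (hR _).mul (ih _ _)
    · exact measurable_const

theorem tsum_walkCount_le {N : ℕ} (hN : ∀ v, G.degree v ≤ N) (Δ : Finset V) (n : ℕ) :
    ∑' w, walkCount G Δ n w ≤ N ^ n * Δ.card := by
  classical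
  induction n with
  | zero =>
    simp only [walkCount, pow_zero, one_mul]
    rw [tsum_eq_sum (s := Δ) fun w hw => if_neg hw]
    simp
  | succ n ih =>
    calc ∑' w, walkCount G Δ (n + 1) w
        = ∑' w, ∑' x, if G.Adj w x then walkCount G Δ n x else 0 := by
          refine tsum_congr fun w => ?_
          rw [tsum_eq_sum (s := G.neighborFinset w) fun x hx => if_neg (by simpa using hx)]
          exact Finset.sum_congr rfl fun x hx => (if_pos (by simpa using hx)).symm
      _ = ∑' x, ∑' w, if G.Adj w x then walkCount G Δ n x else 0 := ENNReal.tsum_comm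
      _ = ∑' x, G.degree x * walkCount G Δ n x := by
          refine tsum_congr fun x => ?_
          rw [tsum_eq_sum (s := G.neighborFinset x)
            fun w hw => if_neg (by simpa [G.adj_comm] using hw),
            Finset.sum_congr rfl fun w hw => if_pos (by simpa [G.adj_comm] using hw)]
          simp
      _ ≤ ∑' x, N * walkCount G Δ n x := by
          refine ENNReal.tsum_le_tsum fun x => ?_
          gcongr
          exact hN x
      _ = N * ∑' x, walkCount G Δ n x := ENNReal.tsum_mul_left
      _ ≤ N * (N ^ n * Δ.card) := by gcongr
      _ = N ^ (n + 1) * Δ.card := by ring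

theorem lintegral_prod_mul_trailSum_le {Ω : Type*} [MeasurableSpace Ω] {Q : Measure Ω}
    {R : Sym2 V → Ω → ℝ≥0∞} (hR : ∀ e, Measurable (R e)) {q : ℝ≥0∞}
    (hq : ∀ P : Finset (Sym2 V), ↑P ⊆ G.edgeSet → ∫⁻ ω, ∏ e ∈ P, R e ω ∂Q ≤ q ^ P.card)
    (Δ : Finset V) (n : ℕ) (S : Set (Sym2 V)) (w : V) (P : Finset (Sym2 V))
    (hP : ↑P ⊆ G.edgeSet) (hPS : Disjoint (↑P) S) :
    ∫⁻ ω, (∏ e ∈ P, R e ω) * trailSum G (fun e => R e ω) Δ n S w ∂Q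
      ≤ q ^ (P.card + n) * walkCount G Δ n w := by
  have hPm : ∀ P : Finset (Sym2 V), Measurable fun ω => ∏ e ∈ P, R e ω :=
    fun P => Finset.measurable_prod _ fun e _ => hR e
  induction n generalizing S w P with
  | zero =>
    simp only [trailSum, walkCount, add_zero]
    rw [lintegral_mul_const _ (hPm P)]
    gcongr
    exact hq P hP
  | succ n ih =>
    simp only [trailSum, walkCount, Finset.mul_sum]
    rw [lintegral_finsetSum']
    · refine Finset.sum_le_sum fun x hx => ?_
      by_cases h : s(w, x) ∈ S
      · simp only [if_pos h]
        have hnot : s(w, x) ∉ P := fun hP' => hPS.le_bot ⟨hP', h⟩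
        have key := ih (S \ {s(w, x)}) x (insert s(w, x) P) (by
            rw [Finset.coe_insert]
            exact insert_subset (by simpa using hx) hP) (by
            rw [Finset.coe_insert, Set.disjoint_insert_left]
            exact ⟨fun h => h.2 rfl, hPS.mono_right sdiff_subset⟩)
        rw [Finset.card_insert_of_notMem hnot] at key
        simp only [Finset.prod_insert hnot] at key
        calc _ = _ := lintegral_congr fun ω => by ring
          _ ≤ _ := key
          _ = _ := by ring
      · simp [h]
    · intro x _
      refine ((hPm P).mul ?_).aemeasurable
      split_ifs
      · exact (hR _).mul (measurable_trailSum hR _ _ _ _)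
      · exact measurable_const

theorem ae_tsum_trailSum_lt_top {Ω : Type*} [MeasurableSpace Ω] {Q : Measure Ω} [Countable V]
    {R : Sym2 V → Ω → ℝ≥0∞} (hR : ∀ e, Measurable (R e)) {q : ℝ≥0∞}
    (hq : ∀ P : Finset (Sym2 V), ↑P ⊆ G.edgeSet → ∫⁻ ω, ∏ e ∈ P, R e ω ∂Q ≤ q ^ P.card)
    {N : ℕ} (hN : ∀ v, G.degree v ≤ N) (hNq : N * q < 1) (Δ : Finset V) :
    ∀ᵐ ω ∂Q, ∑' w, ∑' n, trailSum G (fun e => R e ω) Δ n univ w < ∞ := by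
  have hmeas : ∀ n w, Measurable fun ω => trailSum G (fun e => R e ω) Δ n univ w :=
    fun n w => measurable_trailSum hR Δ n univ w
  refine ae_lt_top (Measurable.tsum fun w => Measurable.tsum fun n => hmeas n w)
    (ne_of_lt ?_)
  calc ∫⁻ ω, ∑' w, ∑' n, trailSum G (fun e => R e ω) Δ n univ w ∂Q
      = ∑' w, ∑' n, ∫⁻ ω, trailSum G (fun e => R e ω) Δ n univ w ∂Q := by
        rw [lintegral_tsum fun w => (Measurable.tsum fun n => hmeas n w).aemeasurable]
        exact tsum_congr fun w => lintegral_tsum fun n => (hmeas n w).aemeasurable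
    _ ≤ ∑' w, ∑' n, q ^ n * walkCount G Δ n w := by
        refine ENNReal.tsum_le_tsum fun w => ENNReal.tsum_le_tsum fun n => ?_
        simpa using lintegral_prod_mul_trailSum_le hR hq Δ n univ w ∅ (by simp) (by simp)
    _ = ∑' n, q ^ n * ∑' w, walkCount G Δ n w := by
        rw [ENNReal.tsum_comm]
        exact tsum_congr fun n => ENNReal.tsum_mul_left
    _ ≤ ∑' n, (N * q) ^ n * Δ.card := by
        refine ENNReal.tsum_le_tsum fun n => ?_
        calc q ^ n * ∑' w, walkCount G Δ n w ≤ q ^ n * (N ^ n * Δ.card) := by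
              gcongr
              exact tsum_walkCount_le hN Δ n
          _ = _ := by rw [mul_pow]; ring
    _ < ∞ := by
        rw [ENNReal.tsum_mul_right, ENNReal.tsum_geometric]
        exact ENNReal.mul_lt_top (ENNReal.inv_lt_top.2 (tsub_pos_of_lt hNq)) (by simp)

end Trails

section Mixture

theorem div_le_mixture_of_real {A K j z c C a r H : ℝ} (hK : 0 < K) (hz : 0 < z)
    (ha : 0 ≤ a) (haC : a * C ≤ c) (hKC : K ≤ C * z) (har : a + r = 1) (hj : j ≤ H * z)
    (h : A + c * H * z ≤ H * K + c * j) : A / K ≤ a * (j / z) + r * H := by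
  have hcz : a * K ≤ c * z := by nlinarith
  have hr : r = 1 - a := by linarith
  rw [div_le_iff₀ hK]
  have e : (a * (j / z) + r * H) * K = (a * j * K + r * H * K * z) / z := by field_simp
  rw [e, le_div_iff₀ hz, hr]
  nlinarith [mul_le_mul_of_nonneg_right hcz (sub_nonneg.2 hj), mul_le_mul_of_nonneg_right h hz.le]

theorem mixture_le_div_of_real {A K j z c C a r H : ℝ} (hK : 0 < K) (hz : 0 < z)
    (ha : 0 ≤ a) (haC : a * C ≤ c) (hKC : K ≤ C * z) (har : a + r = 1) (hj : H * z ≤ j)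
    (h : H * K + c * j ≤ A + c * H * z) : a * (j / z) + r * H ≤ A / K := by
  have hcz : a * K ≤ c * z := by nlinarith
  have hr : r = 1 - a := by linarith
  rw [le_div_iff₀ hK]
  have e : (a * (j / z) + r * H) * K = (a * j * K + r * H * K * z) / z := by field_simp
  rw [e, div_le_iff₀ hz, hr]
  nlinarith [mul_le_mul_of_nonneg_right hcz (sub_nonneg.2 hj), mul_le_mul_of_nonneg_right h hz.le]

variable {α : Type*} [MeasurableSpace α] {ν : Measure α} {j z k : α → ℝ≥0∞} {c C a r H : ℝ≥0∞}

theorem mul_add_mul_le_of_le {k c j h : ℝ≥0∞} (hc : c ≤ k) (hj : j ≤ h) :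
    k * j + c * h ≤ k * h + c * j := by
  obtain ⟨k', rfl⟩ := le_iff_exists_add.1 hc
  obtain ⟨d, rfl⟩ := le_iff_exists_add.1 hj
  calc (c + k') * j + c * (j + d) ≤ (c + k') * j + c * (j + d) + k' * d := le_self_add
    _ = _ := by ring

theorem lintegral_mul_div_le_mixture (hj : Measurable j) (hz : Measurable z) (hk : Measurable k)
    (hck : ∀ s, c ≤ k s) (hkC : ∀ s, k s ≤ C) (hc : c ≠ 0) (hC : C ≠ ∞) (haC : a * C ≤ c)
    (har : a + r = 1) (hjH : ∀ s, j s ≤ H * z s) (hH : H ≠ ∞)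
    (hz0 : ∫⁻ s, z s ∂ν ≠ 0) (hzt : ∫⁻ s, z s ∂ν ≠ ∞) :
    (∫⁻ s, k s * j s ∂ν) / (∫⁻ s, k s * z s ∂ν)
      ≤ a * ((∫⁻ s, j s ∂ν) / ∫⁻ s, z s ∂ν) + r * H := by
  have hkz : Measurable fun s => k s * z s := hk.mul hz
  have hkj : Measurable fun s => k s * j s := hk.mul hj
  have hjH' : ∫⁻ s, j s ∂ν ≤ H * ∫⁻ s, z s ∂ν := by
    rw [← lintegral_const_mul _ hz]
    exact lintegral_mono hjH
  have hKC : ∫⁻ s, k s * z s ∂ν ≤ C * ∫⁻ s, z s ∂ν := by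
    rw [← lintegral_const_mul _ hz]
    exact lintegral_mono fun s => mul_le_mul_left (hkC s) _
  have hcK : c * ∫⁻ s, z s ∂ν ≤ ∫⁻ s, k s * z s ∂ν := by
    rw [← lintegral_const_mul _ hz]
    exact lintegral_mono fun s => mul_le_mul_left (hck s) _
  have hAH : ∫⁻ s, k s * j s ∂ν ≤ H * ∫⁻ s, k s * z s ∂ν := by
    rw [← lintegral_const_mul _ hkz]
    refine lintegral_mono fun s => ?_
    calc k s * j s ≤ k s * (H * z s) := by gcongr; exact hjH s
      _ = _ := by ring
  have hmain : ∫⁻ s, k s * j s ∂ν + c * H * ∫⁻ s, z s ∂ν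
      ≤ H * ∫⁻ s, k s * z s ∂ν + c * ∫⁻ s, j s ∂ν := by
    rw [← lintegral_const_mul _ hz, ← lintegral_const_mul _ hkz,
      ← lintegral_const_mul _ hj, ← lintegral_add_left hkj,
      ← lintegral_add_left (hkz.const_mul _)]
    refine lintegral_mono fun s => ?_
    calc _ = k s * j s + c * (H * z s) := by ring
      _ ≤ k s * (H * z s) + c * j s := mul_add_mul_le_of_le (hck s) (hjH s)
      _ = _ := by ring
  have hct : c ≠ ∞ := by
    rintro rfl
    have := hcK.trans hKC
    rw [ENNReal.top_mul hz0] at this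
    exact (ENNReal.mul_lt_top hC.lt_top hzt.lt_top).not_ge this
  have hat : a ≠ ∞ := ne_top_of_le_ne_top ENNReal.one_ne_top (har ▸ le_self_add)
  have hrt : r ≠ ∞ := ne_top_of_le_ne_top ENNReal.one_ne_top (har ▸ le_add_self)
  generalize ∫⁻ s, z s ∂ν = z' at *
  generalize ∫⁻ s, j s ∂ν = j' at *
  generalize ∫⁻ s, k s * z s ∂ν = K at *
  generalize ∫⁻ s, k s * j s ∂ν = A at *
  have hKt : K ≠ ∞ := ne_top_of_le_ne_top (ENNReal.mul_ne_top hC hzt) hKC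
  have hK0 : K ≠ 0 := fun h => mul_ne_zero hc hz0 (le_zero_iff.1 (h ▸ hcK))
  have hAt : A ≠ ∞ := ne_top_of_le_ne_top (ENNReal.mul_ne_top hH hKt) hAH
  have hjt : j' ≠ ∞ := ne_top_of_le_ne_top (ENNReal.mul_ne_top hH hzt) hjH'
  lift z' to NNReal using hzt
  lift j' to NNReal using hjt
  lift K to NNReal using hKt
  lift A to NNReal using hAt
  lift a to NNReal using hat
  lift r to NNReal using hrt
  lift c to NNReal using hct
  lift C to NNReal using hC
  lift H to NNReal using hH
  norm_cast at *
  rw [← ENNReal.coe_div hK0, ← ENNReal.coe_div hz0]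
  norm_cast
  rw [← NNReal.coe_le_coe]
  push_cast
  exact div_le_mixture_of_real (c := c) (C := C) (by positivity) (by positivity) a.2
    (by exact_mod_cast haC) (by exact_mod_cast hKC) (by exact_mod_cast har)
    (by exact_mod_cast hjH') (by exact_mod_cast hmain)

theorem mixture_le_lintegral_mul_div (hj : Measurable j) (hz : Measurable z) (hk : Measurable k)
    (hck : ∀ s, c ≤ k s) (hkC : ∀ s, k s ≤ C) (hc : c ≠ 0) (hC : C ≠ ∞) (haC : a * C ≤ c)
    (har : a + r = 1) (hjH : ∀ s, H * z s ≤ j s) (hjz : ∀ s, j s ≤ z s) (hH : H ≠ ∞)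
    (hz0 : ∫⁻ s, z s ∂ν ≠ 0) (hzt : ∫⁻ s, z s ∂ν ≠ ∞) :
    a * ((∫⁻ s, j s ∂ν) / ∫⁻ s, z s ∂ν) + r * H
      ≤ (∫⁻ s, k s * j s ∂ν) / (∫⁻ s, k s * z s ∂ν) := by
  have hjz' : ∫⁻ s, j s ∂ν ≤ ∫⁻ s, z s ∂ν := lintegral_mono hjz
  have hkz : Measurable fun s => k s * z s := hk.mul hz
  have hkj : Measurable fun s => k s * j s := hk.mul hj
  have hjH' : H * ∫⁻ s, z s ∂ν ≤ ∫⁻ s, j s ∂ν := by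
    rw [← lintegral_const_mul _ hz]
    exact lintegral_mono hjH
  have hKC : ∫⁻ s, k s * z s ∂ν ≤ C * ∫⁻ s, z s ∂ν := by
    rw [← lintegral_const_mul _ hz]
    exact lintegral_mono fun s => mul_le_mul_left (hkC s) _
  have hcK : c * ∫⁻ s, z s ∂ν ≤ ∫⁻ s, k s * z s ∂ν := by
    rw [← lintegral_const_mul _ hz]
    exact lintegral_mono fun s => mul_le_mul_left (hck s) _
  have hAK : ∫⁻ s, k s * j s ∂ν ≤ ∫⁻ s, k s * z s ∂ν :=
    lintegral_mono fun s => mul_le_mul_right (hjz s) _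
  have hmain : H * ∫⁻ s, k s * z s ∂ν + c * ∫⁻ s, j s ∂ν
      ≤ ∫⁻ s, k s * j s ∂ν + c * H * ∫⁻ s, z s ∂ν := by
    rw [← lintegral_const_mul _ hz, ← lintegral_const_mul _ hkz,
      ← lintegral_const_mul _ hj, ← lintegral_add_left hkj,
      ← lintegral_add_left (hkz.const_mul _)]
    refine lintegral_mono fun s => ?_
    calc _ = k s * (H * z s) + c * j s := by ring
      _ ≤ k s * j s + c * (H * z s) := mul_add_mul_le_of_le (hck s) (hjH s)
      _ = _ := by ring
  have hct : c ≠ ∞ := by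
    rintro rfl
    have := hcK.trans hKC
    rw [ENNReal.top_mul hz0] at this
    exact (ENNReal.mul_lt_top hC.lt_top hzt.lt_top).not_ge this
  have hat : a ≠ ∞ := ne_top_of_le_ne_top ENNReal.one_ne_top (har ▸ le_self_add)
  have hrt : r ≠ ∞ := ne_top_of_le_ne_top ENNReal.one_ne_top (har ▸ le_add_self)
  generalize ∫⁻ s, z s ∂ν = z' at *
  generalize ∫⁻ s, j s ∂ν = j' at *
  generalize ∫⁻ s, k s * z s ∂ν = K at *
  generalize ∫⁻ s, k s * j s ∂ν = A at *
  have hKt : K ≠ ∞ := ne_top_of_le_ne_top (ENNReal.mul_ne_top hC hzt) hKC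
  have hK0 : K ≠ 0 := fun h => mul_ne_zero hc hz0 (le_zero_iff.1 (h ▸ hcK))
  have hAt : A ≠ ∞ := ne_top_of_le_ne_top hKt hAK
  have hjt : j' ≠ ∞ := ne_top_of_le_ne_top hzt hjz'
  lift z' to NNReal using hzt
  lift j' to NNReal using hjt
  lift K to NNReal using hKt
  lift A to NNReal using hAt
  lift a to NNReal using hat
  lift r to NNReal using hrt
  lift c to NNReal using hct
  lift C to NNReal using hC
  lift H to NNReal using hH
  norm_cast at *
  rw [← ENNReal.coe_div hK0, ← ENNReal.coe_div hz0]
  norm_cast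
  rw [← NNReal.coe_le_coe]
  push_cast
  exact mixture_le_div_of_real (c := c) (C := C) (by positivity) (by positivity) a.2
    (by exact_mod_cast haC) (by exact_mod_cast hKC) (by exact_mod_cast har)
    (by exact_mod_cast hjH') (by exact_mod_cast hmain)

end Mixture

section Conditional

variable {V α : Type*} [MeasurableSpace α]

/-- Positive edge weights `w e` that depend on the spins at the ends of `e` only, and whose relative
oscillation is controlled by `r e`. -/
structure IsEdgeWeight (w : Sym2 V → (V → α) → ℝ≥0∞) (r : Sym2 V → ℝ≥0∞) : Prop where
  measurable : ∀ e, Measurable (w e)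
  congr : ∀ e y y', (∀ i ∈ e, y i = y' i) → w e y = w e y'
  bounds : ∀ e, ∃ c C a, c ≠ 0 ∧ C ≠ ∞ ∧ a * C ≤ c ∧ a + r e = 1 ∧ ∀ y, c ≤ w e y ∧ w e y ≤ C

namespace IsEdgeWeight

variable {w : Sym2 V → (V → α) → ℝ≥0∞} {r : Sym2 V → ℝ≥0∞}

theorem ne_zero (hw : IsEdgeWeight w r) (e : Sym2 V) (y : V → α) : w e y ≠ 0 := by
  obtain ⟨c, C, a, hc, -, -, -, h⟩ := hw.bounds e
  exact fun h0 => hc (le_zero_iff.1 (h0 ▸ (h y).1))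

theorem ne_top (hw : IsEdgeWeight w r) (e : Sym2 V) (y : V → α) : w e y ≠ ∞ := by
  obtain ⟨c, C, a, -, hC, -, -, h⟩ := hw.bounds e
  exact ne_top_of_le_ne_top hC (h y).2

theorem measurable_prod (hw : IsEdgeWeight w r) (S : Finset (Sym2 V)) :
    Measurable fun u => ∏ e ∈ S, w e u :=
  Finset.measurable_prod _ fun e _ => hw.measurable e

theorem prod_bounds (hw : IsEdgeWeight w r) (S : Finset (Sym2 V)) :
    ∃ c C, c ≠ 0 ∧ C ≠ ∞ ∧ ∀ y, c ≤ ∏ e ∈ S, w e y ∧ ∏ e ∈ S, w e y ≤ C := by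
  choose c C a hc hC _ _ h using hw.bounds
  exact ⟨∏ e ∈ S, c e, ∏ e ∈ S, C e, Finset.prod_ne_zero_iff.2 fun e _ => hc e,
    ENNReal.prod_ne_top fun e _ => hC e,
    fun y => ⟨Finset.prod_le_prod' fun e _ => (h e y).1, Finset.prod_le_prod' fun e _ => (h e y).2⟩⟩

end IsEdgeWeight

variable [DecidableEq V]

/-- The unnormalized conditional expectation of `g` in the volume `Λ` with edge set `S`. -/
def condInt (χ : V → Measure α) (w : Sym2 V → (V → α) → ℝ≥0∞) (Λ : Finset V) (S : Finset (Sym2 V))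
    (g : (V → α) → ℝ≥0∞) : (V → α) → ℝ≥0∞ :=
  ∫⋯∫⁻_Λ, (fun u => g u * ∏ e ∈ S, w e u) ∂χ

/-- The conditional expectation of `g` in the volume `Λ` with edge set `S`. -/
def condAvg (χ : V → Measure α) (w : Sym2 V → (V → α) → ℝ≥0∞) (Λ : Finset V) (S : Finset (Sym2 V))
    (g : (V → α) → ℝ≥0∞) (y : V → α) : ℝ≥0∞ :=
  condInt χ w Λ S g y / condInt χ w Λ S 1 y

variable {χ : V → Measure α} {w : Sym2 V → (V → α) → ℝ≥0∞}
  {r : Sym2 V → ℝ≥0∞} {Λ : Finset V} {S : Finset (Sym2 V)} {g : (V → α) → ℝ≥0∞}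

theorem condInt_mono {g' : (V → α) → ℝ≥0∞} (hg : g ≤ g') (y : V → α) :
    condInt χ w Λ S g y ≤ condInt χ w Λ S g' y :=
  lmarginal_mono (fun u => mul_le_mul_left (hg u) _) y

theorem condAvg_le_one (hg : g ≤ 1) (y : V → α) : condAvg χ w Λ S g y ≤ 1 :=
  ENNReal.div_le_of_le_mul (by simpa using condInt_mono hg y)

theorem condInt_of_notMem (hw : IsEdgeWeight w r) (hg : Measurable g) {e : Sym2 V} (he : e ∈ S)
    (heΛ : ∀ i ∈ e, i ∉ Λ) (y : V → α) :
    condInt χ w Λ S g y = w e y * condInt χ w Λ (S.erase e) g y := by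
  have hm : Measurable fun u => g u * ∏ e ∈ S.erase e, w e u := hg.mul (hw.measurable_prod _)
  refine Eq.trans ?_ (lintegral_const_mul _ (hm.comp measurable_updateFinset))
  refine lintegral_congr fun u => ?_
  beta_reduce
  rw [← Finset.mul_prod_erase _ _ he, hw.congr e _ y fun i hi => by
    simp [Function.updateFinset, heΛ i hi]]
  ring

theorem condInt_congr (hw : IsEdgeWeight w r) {D : Set V} (hg : DependsOn g D)
    {y y' : V → α} (hy : ∀ i ∈ D, i ∉ Λ → y i = y' i)
    (hyS : ∀ e ∈ S, ∀ i ∈ e, i ∉ Λ → y i = y' i) :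
    condInt χ w Λ S g y = condInt χ w Λ S g y' := by
  refine lintegral_congr fun u => ?_
  have key : ∀ i, (i ∉ Λ → y i = y' i) →
      Function.updateFinset y Λ u i = Function.updateFinset y' Λ u i := fun i hi => by
    by_cases h : i ∈ Λ <;> simp [Function.updateFinset, h]
    exact hi h
  beta_reduce
  rw [hg fun i hi => key i (hy i hi),
    Finset.prod_congr rfl fun e he => hw.congr e _ _ fun i hi => key i (hyS e he i hi)]

theorem condAvg_of_notMem (hw : IsEdgeWeight w r) (hg : Measurable g) {e : Sym2 V} (he : e ∈ S)
    (heΛ : ∀ i ∈ e, i ∉ Λ) (y : V → α) :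
    condAvg χ w Λ S g y = condAvg χ w Λ (S.erase e) g y := by
  rw [condAvg, condAvg, condInt_of_notMem hw hg he heΛ, condInt_of_notMem hw measurable_one he heΛ,
    ENNReal.mul_div_mul_left _ _ (hw.ne_zero e y) (hw.ne_top e y)]

theorem condAvg_of_subset (hw : IsEdgeWeight w r) (hg : Measurable g) {T : Finset (Sym2 V)}
    (hST : S ⊆ T) (hT : ∀ e ∈ T, e ∉ S → ∀ i ∈ e, i ∉ Λ) (y : V → α) :
    condAvg χ w Λ T g y = condAvg χ w Λ S g y := by
  induction T using Finset.strongInduction with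
  | H T ih =>
    by_cases h : T ⊆ S
    · rw [h.antisymm hST]
    · obtain ⟨e, he, heS⟩ := Finset.not_subset.1 h
      rw [condAvg_of_notMem hw hg he (hT e he heS)]
      exact ih _ (Finset.erase_ssubset he) (Finset.subset_erase.2 ⟨hST, heS⟩)
        fun e' he' => hT e' (Finset.mem_of_mem_erase he')

theorem condAvg_congr (hw : IsEdgeWeight w r) {D : Set V} (hg : DependsOn g D)
    {y y' : V → α} (hy : ∀ i ∈ D, i ∉ Λ → y i = y' i)
    (hyS : ∀ e ∈ S, ∀ i ∈ e, i ∉ Λ → y i = y' i) :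
    condAvg χ w Λ S g y = condAvg χ w Λ S g y' := by
  rw [condAvg, condAvg, condInt_congr hw hg hy hyS, condInt_congr hw (D := ∅) (fun _ _ _ => rfl)
    (by simp) hyS]

variable [∀ i, IsProbabilityMeasure (χ i)]

theorem measurable_condInt (hw : IsEdgeWeight w r) (hg : Measurable g) :
    Measurable (condInt χ w Λ S g) :=
  (hg.mul (hw.measurable_prod S)).lmarginal χ

theorem measurable_condAvg (hw : IsEdgeWeight w r) (hg : Measurable g) :
    Measurable (condAvg χ w Λ S g) :=
  (measurable_condInt hw hg).div (measurable_condInt hw measurable_one)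

theorem condInt_one_ne_zero (hw : IsEdgeWeight w r) (y : V → α) :
    condInt χ w Λ S 1 y ≠ 0 := by
  obtain ⟨c, C, hc, -, h⟩ := hw.prod_bounds S
  have : c ≤ condInt χ w Λ S 1 y := by
    calc c = ∫⁻ _, c ∂(Measure.pi fun i : Λ => χ i) := by simp
      _ ≤ _ := lintegral_mono fun u => by simpa using (h _).1
  exact fun h0 => hc (le_zero_iff.1 (h0 ▸ this))

theorem condInt_one_ne_top (hw : IsEdgeWeight w r) (y : V → α) :
    condInt χ w Λ S 1 y ≠ ∞ := by
  obtain ⟨c, C, -, hC, h⟩ := hw.prod_bounds S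
  refine ne_top_of_le_ne_top hC ?_
  calc condInt χ w Λ S 1 y ≤ ∫⁻ _, C ∂(Measure.pi fun i : Λ => χ i) :=
        lintegral_mono fun u => by simpa using (h _).2
    _ = C := by simp

theorem condInt_erase (hw : IsEdgeWeight w r) (hg : Measurable g) {x : V} (hx : x ∈ Λ) (y : V → α) :
    condInt χ w Λ S g y
      = ∫⁻ s, condInt χ w (Λ.erase x) S g (Function.update y x s) ∂χ x :=
  lmarginal_erase _ (hg.mul (hw.measurable_prod S)) hx y

theorem condAvg_condAvg (hw : IsEdgeWeight w r) (hg : Measurable g) {Λ' : Finset V} (hΛ : Λ ⊆ Λ')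
    (y : V → α) : condAvg χ w Λ' S (condAvg χ w Λ S g) y = condAvg χ w Λ' S g y := by
  have hm : Measurable fun u => g u * ∏ e ∈ S, w e u := hg.mul (hw.measurable_prod _)
  have hm' : Measurable fun u => condAvg χ w Λ S g u * ∏ e ∈ S, w e u :=
    (measurable_condAvg hw hg).mul (hw.measurable_prod _)
  have hwm : Measurable fun u => ∏ e ∈ S, w e u := hw.measurable_prod _
  rw [condAvg, condAvg]
  congr 1
  simp only [condInt]
  rw [← Finset.sdiff_union_of_subset hΛ, lmarginal_union χ _ hm Finset.sdiff_disjoint,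
    lmarginal_union χ _ hm' Finset.sdiff_disjoint]
  congr 1
  ext y
  have h1 : ∀ u, condAvg χ w Λ S g (Function.updateFinset y Λ u) = condAvg χ w Λ S g y := fun u => by
    have : ∀ f, condInt χ w Λ S f (Function.updateFinset y Λ u) = condInt χ w Λ S f y := fun f =>
      lmarginal_congr χ _ fun i hi => by simp [Function.updateFinset, hi]
    rw [condAvg, condAvg, this, this]
  simp only [lmarginal, h1]
  refine (lintegral_const_mul _ (hwm.comp measurable_updateFinset)).trans ?_
  have h2 : condInt χ w Λ S 1 y
      = ∫⁻ u, ∏ e ∈ S, w e (Function.updateFinset y Λ u) ∂(Measure.pi fun i : Λ => χ i) := by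
    simp [condInt, lmarginal]
  simp only [Function.comp_def]
  rw [← h2, condAvg, ENNReal.div_mul_cancel (condInt_one_ne_zero hw y) (condInt_one_ne_top hw y)]
  rfl

/-- The total weight of the trails that join the set `W` to `Δ` along edges of `S`. -/
def trailBound (G : SimpleGraph V) [G.LocallyFinite] (r : Sym2 V → ℝ≥0∞) (Δ : Finset V)
    (S : Set (Sym2 V)) (W : Set V) : ℝ≥0∞ :=
  ∑' v, W.indicator (fun v => ∑' n, trailSum G r Δ n S v) v

variable {G : SimpleGraph V} [G.LocallyFinite] {Δ : Finset V}

theorem trailBound_mono {S T : Set (Sym2 V)} (hST : S ⊆ T) (W : Set V) :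
    trailBound G r Δ S W ≤ trailBound G r Δ T W :=
  ENNReal.tsum_le_tsum fun v => indicator_le_indicator
    (ENNReal.tsum_le_tsum fun n => trailSum_mono r Δ n hST v)

theorem trailBound_insert {S : Set (Sym2 V)} {W : Set V} {x : V} (hx : x ∉ W) :
    trailBound G r Δ S (insert x W) = trailBound G r Δ S W + ∑' n, trailSum G r Δ n S x := by
  rw [trailBound, ← union_singleton, indicator_union_of_disjoint (by simpa using hx)]
  beta_reduce
  rw [ENNReal.tsum_add, trailBound]
  congr 1
  rw [tsum_eq_single x fun v hv => by simp [hv]]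
  simp

theorem trailBound_remove_edge_add_le {S : Set (Sym2 V)} {W : Set V} {v x : V}
    (hadj : G.Adj v x) (hS : s(v, x) ∈ S) (hv : v ∈ W) :
    trailBound G r Δ (S \ {s(v, x)}) W + r s(v, x) * ∑' n, trailSum G r Δ n (S \ {s(v, x)}) x
      ≤ trailBound G r Δ S W := by
  rw [trailBound, trailBound, ENNReal.tsum_eq_add_tsum_ite v,
    ENNReal.tsum_eq_add_tsum_ite (f := fun u => W.indicator _ u) v, add_right_comm]
  refine add_le_add ?_ (ENNReal.tsum_le_tsum fun u => ?_)
  · simpa [hv] using tsum_trailSum_remove_edge_add_le r Δ hadj hS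
  · split_ifs
    · exact le_rfl
    · exact indicator_le_indicator
        (ENNReal.tsum_le_tsum fun n => trailSum_mono r Δ n sdiff_subset u)

theorem one_le_trailBound {S : Set (Sym2 V)} {W : Set V} {v : V} (hv : v ∈ W) (hvΔ : v ∈ Δ) :
    1 ≤ trailBound G r Δ S W := by
  refine le_trans ?_ (ENNReal.le_tsum v)
  rw [indicator_of_mem hv]
  refine le_trans ?_ (ENNReal.le_tsum 0)
  simp [trailSum, hvΔ]

/-- One step of the disagreement estimate: an edge joining the disagreement set to `Λ` either is
switched off, or passes the disagreement on to its end in `Λ`. -/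
theorem condAvg_le_of_erase_edge (hw : IsEdgeWeight w r) (hg : Measurable g) (hg1 : g ≤ 1)
    {v x : V} (he : s(v, x) ∈ S) (hv : v ∉ Λ) (hx : x ∈ Λ) {y y' : V → α} {B₀ B₁ : ℝ≥0∞}
    (h₀ : condAvg χ w Λ (S.erase s(v, x)) g y ≤ condAvg χ w Λ (S.erase s(v, x)) g y' + B₀)
    (h₁ : ∀ s s', condAvg χ w (Λ.erase x) (S.erase s(v, x)) g (Function.update y x s)
      ≤ condAvg χ w (Λ.erase x) (S.erase s(v, x)) g (Function.update y' x s') + (B₀ + B₁)) :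
    condAvg χ w Λ S g y ≤ condAvg χ w Λ S g y' + (B₀ + r s(v, x) * B₁) := by
  obtain ⟨c, C, a, hc, hC, haC, har, hb⟩ := hw.bounds s(v, x)
  set e := s(v, x) with he_def
  set I := condInt χ w (Λ.erase x) (S.erase e) with hI
  set H := ⨆ s, condAvg χ w (Λ.erase x) (S.erase e) g (Function.update y x s) with hH
  have hH1 : H ≤ 1 := iSup_le fun s => condAvg_le_one hg1 _
  have heΛ : ∀ i ∈ e, i ∉ Λ.erase x := by
    intro i hi
    rcases Sym2.mem_iff.1 hi with rfl | rfl
    · simp [hv]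
    · simp
  have hup : ∀ y : V → α, Measurable fun s => Function.update y x s := fun y => measurable_update y
  have hIm : ∀ {f} (_ : Measurable f) (y : V → α), Measurable fun s => I f (Function.update y x s) :=
    fun hf y => (measurable_condInt hw hf).comp (hup y)
  have hS : ∀ {f} (_ : Measurable f) (y : V → α), condInt χ w Λ S f y
      = ∫⁻ s, w e (Function.update y x s) * I f (Function.update y x s) ∂χ x := fun hf y => by
    rw [condInt_erase hw hf hx]
    exact lintegral_congr fun s => condInt_of_notMem hw hf he heΛ _
  have hSe : ∀ {f} (_ : Measurable f) (y : V → α), condInt χ w Λ (S.erase e) f y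
      = ∫⁻ s, I f (Function.update y x s) ∂χ x := fun hf y => condInt_erase hw hf hx y
  have hupper : condAvg χ w Λ S g y ≤ a * condAvg χ w Λ (S.erase e) g y + r e * H := by
    rw [condAvg, condAvg, hS hg, hS measurable_one, hSe hg, hSe measurable_one]
    refine lintegral_mul_div_le_mixture (hIm hg y) (hIm measurable_one y)
      ((hw.measurable e).comp (hup y)) (fun s => (hb _).1) (fun s => (hb _).2) hc hC haC har
      (fun s => ?_) (ne_top_of_le_ne_top ENNReal.one_ne_top hH1) ?_ ?_
    · rw [← ENNReal.div_le_iff (condInt_one_ne_zero hw _) (condInt_one_ne_top hw _)]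
      exact le_iSup (fun s => condAvg χ w (Λ.erase x) (S.erase e) g (Function.update y x s)) s
    · rw [← hSe measurable_one]
      exact condInt_one_ne_zero hw _
    · rw [← hSe measurable_one]
      exact condInt_one_ne_top hw _
  have hlower : a * condAvg χ w Λ (S.erase e) g y' + r e * (H - (B₀ + B₁))
      ≤ condAvg χ w Λ S g y' := by
    rw [condAvg, condAvg, hS hg, hS measurable_one, hSe hg, hSe measurable_one]
    refine mixture_le_lintegral_mul_div (hIm hg y') (hIm measurable_one y')
      ((hw.measurable e).comp (hup y')) (fun s => (hb _).1) (fun s => (hb _).2) hc hC haC har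
      (fun s => ?_) (fun s => condInt_mono hg1 _)
      (ne_top_of_le_ne_top ENNReal.one_ne_top (tsub_le_self.trans hH1)) ?_ ?_
    · rw [← ENNReal.le_div_iff_mul_le (Or.inl (condInt_one_ne_zero hw _))
        (Or.inl (condInt_one_ne_top hw _)), tsub_le_iff_right]
      exact iSup_le fun s' => h₁ s' s
    · rw [← hSe measurable_one]
      exact condInt_one_ne_zero hw _
    · rw [← hSe measurable_one]
      exact condInt_one_ne_top hw _
  calc condAvg χ w Λ S g y ≤ a * condAvg χ w Λ (S.erase e) g y + r e * H := hupper
    _ ≤ a * (condAvg χ w Λ (S.erase e) g y' + B₀) + r e * (H - (B₀ + B₁) + (B₀ + B₁)) := by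
        gcongr
        exact le_tsub_add
    _ = (a * condAvg χ w Λ (S.erase e) g y' + r e * (H - (B₀ + B₁)))
          + ((a + r e) * B₀ + r e * B₁) := by ring
    _ ≤ condAvg χ w Λ S g y' + (B₀ + r e * B₁) := by
        rw [har, one_mul]
        gcongr

/-- Changing the boundary condition on `W` changes the conditional expectation of a function on `Δ`
by at most the total weight of the trails from `W` to `Δ`. -/
theorem condAvg_le_add_trailBound (hw : IsEdgeWeight w r) (hg : Measurable g) (hg1 : g ≤ 1)
    (hgΔ : DependsOn g (Δ : Set V)) (hSG : ↑S ⊆ G.edgeSet) {W : Set V} (hW : ∀ i ∈ W, i ∉ Λ)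
    {y y' : V → α} (hy : ∀ i ∉ W, i ∉ Λ → y i = y' i) :
    condAvg χ w Λ S g y ≤ condAvg χ w Λ S g y' + trailBound G r Δ S W := by
  induction S using Finset.strongInduction generalizing Λ W y y' with
  | H S ih =>
  by_cases h1 : ∃ e ∈ S, ∀ i ∈ e, i ∉ Λ
  · obtain ⟨e, he, heΛ⟩ := h1
    have hsub : (↑(S.erase e) : Set (Sym2 V)) ⊆ ↑S := by exact_mod_cast S.erase_subset e
    rw [condAvg_of_notMem hw hg he heΛ, condAvg_of_notMem hw hg he heΛ]
    refine (ih _ (Finset.erase_ssubset he) (hsub.trans hSG) hW hy).trans ?_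
    gcongr
    exact trailBound_mono hsub W
  by_cases h2 : ∃ v ∈ W, ∃ x ∈ Λ, s(v, x) ∈ S
  · obtain ⟨v, hv, x, hx, he⟩ := h2
    have hsub : (↑(S.erase s(v, x)) : Set (Sym2 V)) ⊆ ↑S := by
      exact_mod_cast S.erase_subset s(v, x)
    have hxW : x ∉ W := fun h => hW x h hx
    refine (condAvg_le_of_erase_edge (χ := χ) hw hg hg1 he (hW v hv) hx
      (ih _ (Finset.erase_ssubset he) (hsub.trans hSG) hW hy)
      (B₁ := ∑' n, trailSum G r Δ n ↑(S.erase s(v, x)) x) fun s s' => ?_).trans ?_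
    · rw [← trailBound_insert hxW]
      refine ih _ (Finset.erase_ssubset he) (hsub.trans hSG) ?_ ?_
      · rintro i (rfl | hi)
        · simp
        · simp [hW i hi]
      · intro i hi hiΛ
        obtain ⟨hix, hiW⟩ : i ≠ x ∧ i ∉ W := by simpa using hi
        rw [Function.update_of_ne hix, Function.update_of_ne hix]
        exact hy i hiW (by simpa [hix] using hiΛ)
    · gcongr
      rw [Finset.coe_erase]
      exact trailBound_remove_edge_add_le (hSG he) he hv
  push Not at h1 h2
  by_cases h3 : ∃ v ∈ W, v ∈ Δ
  · obtain ⟨v, hv, hvΔ⟩ := h3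
    exact (condAvg_le_one hg1 y).trans ((one_le_trailBound hv hvΔ).trans le_add_self)
  · push Not at h3
    refine le_of_eq_of_le (condAvg_congr hw hgΔ (fun i hi => hy i fun hiW => h3 i hiW hi)
      fun e he i hie => hy i fun hiW => ?_) le_self_add
    obtain ⟨j, hje, hjΛ⟩ := h1 e he
    have hij : i ≠ j := fun h => hW i hiW (h ▸ hjΛ)
    exact h2 i hiW j hjΛ ((Sym2.mem_and_mem_iff hij).1 ⟨hie, hje⟩ ▸ he)

end Conditional

theorem nonempty_iInter_cylinder_of_isCompact {ι α : Type*} [TopologicalSpace α]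
    (J : ℕ → Finset ι) (K : ∀ n, Set (J n → α)) (hcl : ∀ n, IsClosed (K n))
    (hK : ∀ n, IsCompact (K n)) (hne : ∀ n, (⋂ i ≤ n, cylinder (α := fun _ => α) (J i) (K i)).Nonempty) :
    (⋂ n, cylinder (α := fun _ => α) (J n) (K n)).Nonempty := by
  classical
  choose z hz using hne
  have hz' : ∀ i n, i ≤ n → (J i).restrict (z n) ∈ K i := fun i n hin =>
    mem_iInter₂.1 (hz n) i hin
  let u : ℕ → ι → α := fun n j => if ∃ i, j ∈ J i then z n j else z 0 j
  have hu : ∀ i n, i ≤ n → u n ∈ cylinder (α := fun _ => α) (J i) (K i) := by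
    intro i n hin
    have : (J i).restrict (u n) = (J i).restrict (z n) := by
      ext j
      exact if_pos ⟨i, j.2⟩
    simpa [cylinder, this] using hz' i n hin
  have hC : ∀ j, ∃ C : Set α, IsCompact C ∧ ∀ n, u n j ∈ C := by
    intro j
    by_cases h : ∃ i, j ∈ J i
    · obtain ⟨i, hi⟩ := h
      refine ⟨(fun f : J i → α => f ⟨j, hi⟩) '' K i ∪ (fun n => u n j) '' Iio i,
        ((hK i).image (continuous_apply _)).union ((finite_Iio i).image _).isCompact, fun n => ?_⟩
      rcases lt_or_ge n i with hn | hn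
      · exact Or.inr ⟨n, hn, rfl⟩
      · exact Or.inl ⟨_, hu i n hn, rfl⟩
    · exact ⟨{z 0 j}, isCompact_singleton, fun n => if_neg h⟩
  choose C hCc hCu using hC
  obtain ⟨x, -, hx⟩ := (isCompact_univ_pi hCc).exists_clusterPt (f := map u atTop)
    (le_principal_iff.2 (mem_map.2 (Eventually.of_forall fun n j _ => hCu j n)))
  refine ⟨x, mem_iInter.2 fun i => ?_⟩
  have hcyl : IsClosed (cylinder (α := fun _ => α) (J i) (K i)) :=
    (hcl i).preimage (Finset.continuous_restrict _)
  refine hcyl.closure_subset (mem_closure_iff_clusterPt.2 (hx.mono ?_))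
  exact le_principal_iff.2 (mem_map.2 ((eventually_ge_atTop i).mono fun n hn => hu i n hn))

theorem exists_measure_eq_lim_on_cylinders {ι α β : Type*} [TopologicalSpace α] [PolishSpace α]
    [MeasurableSpace α] [BorelSpace α] {l : Filter β} [l.NeBot]
    (P : β → Measure (ι → α)) [∀ b, IsProbabilityMeasure (P b)]
    (m : Set (ι → α) → ℝ≥0∞)
    (hm : ∀ s ∈ measurableCylinders (fun _ : ι => α), Tendsto (fun b => P b s) l (𝓝 (m s)))
    (hunif : ∀ (J : Finset ι) (ε : ℝ≥0∞), 0 < ε → ∃ b, ∀ᶠ b' in l, ∀ B : Set (J → α),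
      MeasurableSet B → P b' (cylinder (α := fun _ => α) J B) ≤ P b (cylinder (α := fun _ => α) J B) + ε) :
    ∃ μ : Measure (ι → α), IsProbabilityMeasure μ ∧
      ∀ s ∈ measurableCylinders (fun _ : ι => α), μ s = m s := by
  classical
  have hring : IsSetRing (measurableCylinders (fun _ : ι => α)) := isSetRing_measurableCylinders
  have hmeas : ∀ {s}, s ∈ measurableCylinders (fun _ : ι => α) → MeasurableSet s :=
    fun hs => MeasurableSet.of_mem_measurableCylinders hs
  have hempty : m ∅ = 0 :=
    tendsto_nhds_unique (hm ∅ hring.empty_mem) (by simp)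
  have hunion : ∀ {s t}, s ∈ measurableCylinders (fun _ : ι => α) →
      t ∈ measurableCylinders (fun _ : ι => α) → Disjoint s t → m (s ∪ t) = m s + m t := by
    intro s t hs ht hst
    refine tendsto_nhds_unique (hm _ (hring.union_mem hs ht)) ?_
    simpa [measure_union hst (hmeas ht)] using (hm s hs).add (hm t ht)
  let c : AddContent ℝ≥0∞ (measurableCylinders (fun _ : ι => α)) :=
    hring.addContent_of_union m hempty hunion
  have hc : ∀ s, c s = m s := fun _ => rfl
  have hle1 : ∀ s ∈ measurableCylinders (fun _ : ι => α), m s ≤ 1 := fun s hs =>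
    le_of_tendsto' (hm s hs) fun b => prob_le_one
  have hzero : ∀ ⦃A : ℕ → Set (ι → α)⦄, (∀ n, A n ∈ measurableCylinders (fun _ : ι => α)) →
      Antitone A → (⋂ n, A n) = ∅ → Tendsto (fun n => c (A n)) atTop (𝓝 0) := by
    intro A hA hanti hinter
    rw [ENNReal.tendsto_atTop_zero]
    intro δ hδ
    obtain ⟨ε, hε, hsum⟩ := ENNReal.exists_pos_sum_of_countable' hδ.ne' ℕ
    choose J S hS hAS using fun n => (mem_measurableCylinders (A n)).1 (hA n)
    have hKex : ∀ n, ∃ K : Set (J n → α), IsCompact K ∧ IsClosed K ∧ K ⊆ S n ∧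
        m (cylinder (α := fun _ => α) (J n) (S n \ K)) ≤ ε n := by
      intro n
      have hε2 : 0 < ε n / 2 := ENNReal.half_pos (hε n).ne'
      obtain ⟨b, hb⟩ := hunif (J n) (ε n / 2) hε2
      have : IsProbabilityMeasure ((P b).map (J n).restrict) :=
        Measure.isProbabilityMeasure_map (by fun_prop)
      obtain ⟨K, hKS, ⟨hKc, hKcl⟩, hKlt⟩ :=
        (innerRegular_isCompact_isClosed_measurableSet_of_finite
          ((P b).map (J n).restrict)).exists_subset_lt_add (by simp) (hS n)
          (measure_ne_top _ _) hε2.ne'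
      refine ⟨K, hKc, hKcl, hKS, ?_⟩
      have hd : MeasurableSet (S n \ K) := (hS n).diff hKcl.measurableSet
      have h1 : P b (cylinder (α := fun _ => α) (J n) (S n \ K)) ≤ ε n / 2 := by
        have : P b (cylinder (α := fun _ => α) (J n) (S n \ K)) = (P b).map (J n).restrict (S n \ K) :=
          (Measure.map_apply (by fun_prop) hd).symm
        rw [this, measure_sdiff hKS hKcl.measurableSet.nullMeasurableSet (measure_ne_top _ _)]
        exact tsub_le_iff_left.2 hKlt.le
      refine le_of_tendsto (hm _ (cylinder_mem_measurableCylinders _ _ hd)) ?_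
      filter_upwards [hb] with b' hb'
      calc _ ≤ _ := hb' _ hd
        _ ≤ ε n / 2 + ε n / 2 := by gcongr
        _ = ε n := ENNReal.add_halves _
    choose K hKc hKcl hKS hKm using hKex
    have hex : ∃ n, (⋂ i ≤ n, cylinder (α := fun _ => α) (J i) (K i)) = ∅ := by
      by_contra! h
      obtain ⟨x, hx⟩ := nonempty_iInter_cylinder_of_isCompact J K hKcl hKc h
      have : x ∈ ⋂ n, A n := mem_iInter.2 fun n => by
        rw [hAS n]
        exact hKS n (mem_iInter.1 hx n)
      simp [hinter] at this
    obtain ⟨N, hN⟩ := hex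
    refine ⟨N, fun n hn => ?_⟩
    have hmem : ∀ i, cylinder (α := fun _ => α) (J i) (S i \ K i) ∈ measurableCylinders (fun _ : ι => α) :=
      fun i => cylinder_mem_measurableCylinders _ _ ((hS i).diff (hKcl i).measurableSet)
    have hsub : A n ⊆ ⋃ i ∈ Finset.range (N + 1), cylinder (α := fun _ => α) (J i) (S i \ K i) := by
      intro x hx
      have hx' : x ∉ ⋂ i ≤ N, cylinder (α := fun _ => α) (J i) (K i) := by simp [hN]
      simp only [mem_iInter, not_forall] at hx'
      obtain ⟨i, hi, hxi⟩ := hx'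
      have : x ∈ A i := hanti (hi.trans hn) hx
      rw [hAS i] at this
      simp only [mem_iUnion, Finset.mem_range]
      exact ⟨i, by omega, this, hxi⟩
    calc c (A n) ≤ c (⋃ i ∈ Finset.range (N + 1), cylinder (α := fun _ => α) (J i) (S i \ K i)) :=
          addContent_mono hring.isSetSemiring (hA n)
            (hring.biUnion_mem _ fun i _ => hmem i) hsub
      _ ≤ ∑ i ∈ Finset.range (N + 1), c (cylinder (α := fun _ => α) (J i) (S i \ K i)) :=
          addContent_biUnion_le hring fun i _ => hmem i
      _ ≤ ∑ i ∈ Finset.range (N + 1), ε i := Finset.sum_le_sum fun i _ => hKm i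
      _ ≤ ∑' i, ε i := ENNReal.sum_le_tsum _
      _ ≤ δ := hsum.le
  have hsub : c.IsSigmaSubadditive :=
    isSigmaSubadditive_of_addContent_iUnion_eq_tsum hring fun f hf hU hd =>
      addContent_iUnion_eq_sum_of_tendsto_zero hring c
        (fun s hs => ((hle1 s hs).trans_lt ENNReal.one_lt_top).ne) hzero hf hU hd
  have heq : ∀ s ∈ measurableCylinders (fun _ : ι => α),
      c.measure hring.isSetSemiring generateFrom_measurableCylinders.ge hsub s = m s :=
    fun s hs => c.measure_eq _ generateFrom_measurableCylinders.symm hsub hs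
  refine ⟨_, ⟨?_⟩, heq⟩
  have huniv : univ ∈ measurableCylinders (fun _ : ι => α) := univ_mem_measurableCylinders _
  rw [heq _ huniv]
  exact tendsto_nhds_unique (hm _ huniv) (by simp)

section Specification

theorem lintegral_le_add_of_measure_lt_le {X : Type*} [MeasurableSpace X] {μ₁ μ₂ : Measure X}
    {f : X → ℝ≥0∞} (hf : Measurable f) (hf1 : f ≤ 1) {ε : ℝ≥0∞}
    (h : ∀ t, μ₁ {x | t < f x} ≤ μ₂ {x | t < f x} + ε) :
    ∫⁻ x, f x ∂μ₁ ≤ ∫⁻ x, f x ∂μ₂ + ε := by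
  have hft : ∀ x, f x ≠ ∞ := fun x => ne_top_of_le_ne_top ENNReal.one_ne_top (hf1 x)
  have key : ∀ μ : Measure X, ∫⁻ x, f x ∂μ
      = ∫⁻ t in Ioi (0 : ℝ), μ {x | ENNReal.ofReal t < f x} := fun μ => by
    have := lintegral_eq_lintegral_meas_lt μ (f := fun x => (f x).toReal)
      (ae_of_all _ fun x => ENNReal.toReal_nonneg) hf.ennreal_toReal.aemeasurable
    simp only [ENNReal.ofReal_toReal (hft _)] at this
    rw [this]
    refine setLIntegral_congr_fun measurableSet_Ioi fun t ht => ?_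
    simp only [← ENNReal.ofReal_lt_iff_lt_toReal (le_of_lt ht) (hft _)]
  rw [key, key]
  calc ∫⁻ t in Ioi (0 : ℝ), μ₁ {x | ENNReal.ofReal t < f x}
      ≤ ∫⁻ t in Ioi (0 : ℝ), (μ₂ {x | ENNReal.ofReal t < f x}
          + (Ioo (0 : ℝ) 1).indicator (fun _ => ε) t) := by
        refine setLIntegral_mono' measurableSet_Ioi fun t ht => ?_
        by_cases h1 : t < 1
        · simpa [indicator_of_mem (show t ∈ Ioo (0 : ℝ) 1 from ⟨ht, h1⟩)]
            using h (ENNReal.ofReal t)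
        · have : {x | ENNReal.ofReal t < f x} = ∅ := by
            ext x
            simpa using (hf1 x).trans (ENNReal.one_le_ofReal.2 (not_lt.1 h1))
          simp [this]
    _ = _ := by
        rw [lintegral_add_right _ (measurable_const.indicator measurableSet_Ioo)]
        congr 1
        rw [lintegral_indicator measurableSet_Ioo, setLIntegral_const,
          Measure.restrict_apply measurableSet_Ioo, inter_eq_left.2 fun t ht => ht.1]
        simp

variable {V α : Type*} [MeasurableSpace α]

theorem exists_eq_cylinder_of_dependsOn [DecidableEq V] [Nonempty (V → α)] {D : Finset V}
    {s : Set (V → α)} (hs : MeasurableSet s) (hD : DependsOn (· ∈ s) (D : Set V)) :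
    ∃ B : Set (D → α), MeasurableSet B ∧ s = cylinder (α := fun _ => α) D B := by
  let y : V → α := Classical.arbitrary _
  refine ⟨(fun z => Function.updateFinset y D z) ⁻¹' s, measurable_updateFinset hs, ?_⟩
  ext u
  rw [mem_cylinder, mem_preimage]
  refine Eq.to_iff (hD fun i hi => ?_)
  simp [Function.updateFinset, Finset.mem_coe.1 hi]

theorem tendsto_of_le_add {P : Finset V → ℝ≥0∞} (hP : ∀ Λ, P Λ ≤ 1) {ε : Finset V → ℝ≥0∞}
    (hε : Tendsto ε atTop (𝓝 0)) (h : ∀ Λ Λ', Λ ⊆ Λ' → P Λ' ≤ P Λ + ε Λ ∧ P Λ ≤ P Λ' + ε Λ) :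
    ∃ a, Tendsto P atTop (𝓝 a) := by
  have hPt : ∀ Λ, P Λ ≠ ∞ := fun Λ => ne_top_of_le_ne_top ENNReal.one_ne_top (hP Λ)
  have hc : CauchySeq fun Λ => (P Λ).toReal := by
    classical
    refine Metric.cauchySeq_iff'.2 fun δ hδ => ?_
    obtain ⟨Λ, hΛ⟩ := (hε.eventually (gt_mem_nhds (ENNReal.ofReal_pos.2 hδ))).exists
    have hΛt : ε Λ ≠ ∞ := ne_top_of_lt hΛ
    refine ⟨Λ, fun Λ' hΛ' => ?_⟩
    have h1 := ENNReal.toReal_mono (ENNReal.add_ne_top.2 ⟨hPt Λ, hΛt⟩) (h Λ Λ' hΛ').1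
    have h2 := ENNReal.toReal_mono (ENNReal.add_ne_top.2 ⟨hPt Λ', hΛt⟩) (h Λ Λ' hΛ').2
    have h3 := (ENNReal.lt_ofReal_iff_toReal_lt hΛt).1 hΛ
    rw [ENNReal.toReal_add (hPt _) hΛt] at h1 h2
    rw [Real.dist_eq, abs_lt]
    constructor <;> linarith
  obtain ⟨a, ha⟩ := cauchySeq_tendsto_of_complete hc
  refine ⟨ENNReal.ofReal a, ?_⟩
  simpa [ENNReal.ofReal_toReal (hPt _)] using ENNReal.tendsto_ofReal ha

/-- A consistent family of local kernels whose dependence on the boundary condition vanishes, locally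
uniformly, in the infinite volume limit has exactly one Gibbs measure. -/
theorem existsUnique_bind_eq_of_uniform [DecidableEq V] [TopologicalSpace α] [PolishSpace α]
    [BorelSpace α] [Nonempty (V → α)] (γ : Finset V → (V → α) → Measure (V → α))
    (hγ : ∀ Λ y, IsProbabilityMeasure (γ Λ y)) (hmeas : ∀ Λ, Measurable (γ Λ))
    (hempty : γ ∅ = Measure.dirac)
    (hcons : ∀ Λ Λ' y, Λ ⊆ Λ' → (γ Λ' y).bind (γ Λ) = γ Λ' y)
    (hloc : ∀ Λ (Δ : Finset V), ∃ D : Finset V, ∀ B : Set (Δ → α), MeasurableSet B →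
      DependsOn (fun y => γ Λ y (cylinder (α := fun _ => α) Δ B)) (D : Set V))
    (hunif : ∀ Δ : Finset V, ∃ ε : Finset V → ℝ≥0∞, Tendsto ε atTop (𝓝 0) ∧
      ∀ Λ y y' (B : Set (Δ → α)), MeasurableSet B →
        γ Λ y (cylinder (α := fun _ => α) Δ B) ≤ γ Λ y' (cylinder (α := fun _ => α) Δ B) + ε Λ) :
    ∃! μ : Measure (V → α), IsProbabilityMeasure μ ∧
      ∀ Λ : Finset V, Λ.Nonempty → μ.bind (γ Λ) = μ := by
  choose ε hε hγε using hunif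
  have hcyl : ∀ {Δ : Finset V} {B : Set (Δ → α)}, MeasurableSet B →
      MeasurableSet (cylinder (α := fun _ => α) Δ B) := fun hB => MeasurableSet.cylinder _ hB
  have key : ∀ (μ : Measure (V → α)) [IsProbabilityMeasure μ] (Λ Δ : Finset V) (y : V → α)
      (B : Set (Δ → α)), μ.bind (γ Λ) = μ → MeasurableSet B →
      μ (cylinder (α := fun _ => α) Δ B) ≤ γ Λ y (cylinder (α := fun _ => α) Δ B) + ε Δ Λ ∧
      γ Λ y (cylinder (α := fun _ => α) Δ B) ≤ μ (cylinder (α := fun _ => α) Δ B) + ε Δ Λ := by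
    intro μ _ Λ Δ y B hμ hB
    have hb : μ (cylinder (α := fun _ => α) Δ B)
        = ∫⁻ u, γ Λ u (cylinder (α := fun _ => α) Δ B) ∂μ := by
      conv_lhs => rw [← hμ]
      exact Measure.bind_apply (hcyl hB) (hmeas Λ).aemeasurable
    constructor
    · rw [hb]
      calc _ ≤ ∫⁻ _, (γ Λ y (cylinder (α := fun _ => α) Δ B) + ε Δ Λ) ∂μ :=
            lintegral_mono fun u => hγε Δ Λ u y B hB
        _ = _ := by simp
    · rw [hb]
      calc _ = ∫⁻ _, γ Λ y (cylinder (α := fun _ => α) Δ B) ∂μ := by simp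
        _ ≤ ∫⁻ u, (γ Λ u (cylinder (α := fun _ => α) Δ B) + ε Δ Λ) ∂μ :=
            lintegral_mono fun u => hγε Δ Λ y u B hB
        _ = _ := by
            rw [lintegral_add_right _ measurable_const]
            simp
  have hext : ∀ (μ ν : Measure (V → α)) [IsProbabilityMeasure μ] [IsProbabilityMeasure ν],
      (∀ (Δ : Finset V) (B : Set (Δ → α)), MeasurableSet B →
        μ (cylinder (α := fun _ => α) Δ B) = ν (cylinder (α := fun _ => α) Δ B)) → μ = ν := by
    intro μ ν _ _ h
    refine ext_of_generate_finite _ (generateFrom_measurableCylinders (α := fun _ : V => α)).symm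
      isPiSystem_measurableCylinders (fun s hs => ?_) (by simp)
    obtain ⟨Δ, B, hB, rfl⟩ := (mem_measurableCylinders s).1 hs
    exact h Δ B hB
  let y₀ : V → α := Classical.arbitrary _
  have hP : ∀ (Δ : Finset V) (B : Set (Δ → α)), MeasurableSet B → ∀ Λ Λ', Λ ⊆ Λ' →
      γ Λ' y₀ (cylinder (α := fun _ => α) Δ B)
        ≤ γ Λ y₀ (cylinder (α := fun _ => α) Δ B) + ε Δ Λ ∧
      γ Λ y₀ (cylinder (α := fun _ => α) Δ B)
        ≤ γ Λ' y₀ (cylinder (α := fun _ => α) Δ B) + ε Δ Λ :=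
    fun Δ B hB Λ Λ' h => key (γ Λ' y₀) Λ Δ y₀ B (hcons Λ Λ' y₀ h) hB
  have hlim : ∀ s : Set (V → α), s ∈ measurableCylinders (fun _ : V => α) →
      ∃ a, Tendsto (fun Λ => γ Λ y₀ s) atTop (𝓝 a) := by
    intro s hs
    obtain ⟨Δ, B, hB, rfl⟩ := (mem_measurableCylinders s).1 hs
    exact tendsto_of_le_add (fun Λ => prob_le_one) (hε Δ) (hP Δ B hB)
  obtain ⟨m, hm⟩ : ∃ m : Set (V → α) → ℝ≥0∞, ∀ s ∈ measurableCylinders (fun _ : V => α),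
      Tendsto (fun Λ => γ Λ y₀ s) atTop (𝓝 (m s)) := by
    choose! m hm using hlim
    exact ⟨m, hm⟩
  obtain ⟨μ, hμ, hμm⟩ := exists_measure_eq_lim_on_cylinders (fun Λ => γ Λ y₀) m hm
    fun J δ hδ => by
      obtain ⟨Λ, hΛ⟩ := ((hε J).eventually (gt_mem_nhds hδ)).exists
      refine ⟨Λ, (eventually_ge_atTop Λ).mono fun Λ' hΛ' B hB => ?_⟩
      exact (hP J B hB Λ Λ' hΛ').1.trans (by gcongr)
  have hμlim : ∀ (Δ : Finset V) (B : Set (Δ → α)), MeasurableSet B →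
      Tendsto (fun Λ => γ Λ y₀ (cylinder (α := fun _ => α) Δ B)) atTop
        (𝓝 (μ (cylinder (α := fun _ => α) Δ B))) := fun Δ B hB => by
    have hs := cylinder_mem_measurableCylinders (α := fun _ : V => α) Δ B hB
    rw [hμm _ hs]
    exact hm _ hs
  have hμε : ∀ (Δ : Finset V) (B : Set (Δ → α)), MeasurableSet B → ∀ Λ,
      μ (cylinder (α := fun _ => α) Δ B)
        ≤ γ Λ y₀ (cylinder (α := fun _ => α) Δ B) + ε Δ Λ ∧
      γ Λ y₀ (cylinder (α := fun _ => α) Δ B)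
        ≤ μ (cylinder (α := fun _ => α) Δ B) + ε Δ Λ := fun Δ B hB Λ =>
    ⟨le_of_tendsto (hμlim Δ B hB)
      ((eventually_ge_atTop Λ).mono fun Λ' h => (hP Δ B hB Λ Λ' h).1),
    ge_of_tendsto ((hμlim Δ B hB).add_const _)
      ((eventually_ge_atTop Λ).mono fun Λ' h => (hP Δ B hB Λ Λ' h).2)⟩
  have hbindprob : ∀ Λ, IsProbabilityMeasure (μ.bind (γ Λ)) := fun Λ => by
    constructor
    rw [Measure.bind_apply .univ (hmeas Λ).aemeasurable]
    simp
  refine ⟨μ, ⟨hμ, fun Λ _ => hext _ _ fun Δ B hB => ?_⟩, fun ν ⟨hν, hνγ⟩ => ?_⟩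
  · rw [Measure.bind_apply (hcyl hB) (hmeas Λ).aemeasurable]
    obtain ⟨D, hD⟩ := hloc Λ Δ
    have hf : Measurable fun y => γ Λ y (cylinder (α := fun _ => α) Δ B) :=
      (Measure.measurable_coe (hcyl hB)).comp (hmeas Λ)
    have hlevel : ∀ t, ∃ B' : Set (D → α), MeasurableSet B' ∧
        {y | t < γ Λ y (cylinder (α := fun _ => α) Δ B)} = cylinder (α := fun _ => α) D B' :=
      fun t => exists_eq_cylinder_of_dependsOn (measurableSet_lt measurable_const hf)
        fun y y' h => by simp only [mem_ofPred_eq, hD B hB h]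
    have hf1 : (fun y => γ Λ y (cylinder (α := fun _ => α) Δ B)) ≤ 1 := fun y => prob_le_one
    have hint : ∀ K, Λ ⊆ K → ∫⁻ y, γ Λ y (cylinder (α := fun _ => α) Δ B) ∂(γ K y₀)
        = γ K y₀ (cylinder (α := fun _ => α) Δ B) := fun K hK => by
      conv_rhs => rw [← hcons Λ K y₀ hK]
      exact (Measure.bind_apply (hcyl hB) (hmeas Λ).aemeasurable).symm
    have hlim0 := (hμlim Δ B hB).add (hε D)
    rw [add_zero] at hlim0
    refine le_antisymm (ge_of_tendsto hlim0 ((eventually_ge_atTop Λ).mono fun K hK => ?_))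
      (le_of_tendsto_of_tendsto (hμlim Δ B hB) (b := atTop)
        (by simpa using (tendsto_const_nhds (x := ∫⁻ y, γ Λ y _ ∂μ)).add (hε D))
        ((eventually_ge_atTop Λ).mono fun K hK => ?_))
    · rw [← hint K hK]
      refine lintegral_le_add_of_measure_lt_le hf hf1 fun t => ?_
      obtain ⟨B', hB', hBt⟩ := hlevel t
      rw [hBt]
      exact (hμε D B' hB' K).1
    · beta_reduce
      rw [← hint K hK]
      refine lintegral_le_add_of_measure_lt_le hf hf1 fun t => ?_
      obtain ⟨B', hB', hBt⟩ := hlevel t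
      rw [hBt]
      exact (hμε D B' hB' K).2
  · have hνγ' : ∀ Λ, ν.bind (γ Λ) = ν := fun Λ => by
      rcases Λ.eq_empty_or_nonempty with rfl | h
      · rw [hempty, Measure.bind_dirac]
      · exact hνγ Λ h
    refine hext _ _ fun Δ B hB => tendsto_nhds_unique_of_eventuallyEq ?_ (hμlim Δ B hB)
      (Eventually.of_forall fun _ => rfl)
    refine tendsto_of_tendsto_of_tendsto_of_le_of_le
      (g := fun Λ => ν (cylinder (α := fun _ => α) Δ B) - ε Δ Λ)
      (h := fun Λ => ν (cylinder (α := fun _ => α) Δ B) + ε Δ Λ) ?_ ?_ (fun Λ => ?_) fun Λ => ?_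
    · simpa using ENNReal.Tendsto.sub tendsto_const_nhds (hε Δ)
        (Or.inl (measure_ne_top ν (cylinder (α := fun _ => α) Δ B)))
    · simpa using tendsto_const_nhds.add (hε Δ)
    · exact tsub_le_iff_right.2 (key ν Λ Δ y₀ B (hνγ' Λ) hB).1
    · exact (key ν Λ Δ y₀ B (hνγ' Λ) hB).2

end Specification

section LoopSpace

variable {M : Type*} [MetricSpace M]

theorem continuous_path : Continuous (Loop.path : Loop M → C(unitInterval, M)) :=
  continuous_subtype_val

variable [CompactSpace M]

instance : CompleteSpace (Loop M) :=
  IsClosed.completeSpace_coe (s := {x : C(unitInterval, M) | x 0 = x 1})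
    (hs := isClosed_eq (continuous_eval_const 0) (continuous_eval_const 1))

instance : SecondCountableTopology (Loop M) :=
  inferInstanceAs (SecondCountableTopology {x : C(unitInterval, M) // x 0 = x 1})

theorem abs_pathV_le (v : C(M × M, ℝ)) (x y : Loop M) : |pathV v x y| ≤ ‖v‖ := by
  simpa [pathV] using norm_integral_le_of_norm_le_const (μ := (volume : Measure unitInterval))
    (f := fun τ => v (x.path τ, y.path τ)) (C := ‖v‖) (ae_of_all _ fun τ => v.norm_coe_le_norm _)

theorem measurable_pathV (v : C(M × M, ℝ)) : Measurable fun p : Loop M × Loop M => pathV v p.1 p.2 := by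
  refine Continuous.measurable ?_
  have h : Continuous fun q : (Loop M × Loop M) × unitInterval =>
      v (q.1.1.path q.2, q.1.2.path q.2) := by
    have h1 : Continuous fun q : (Loop M × Loop M) × unitInterval => q.1.1.path q.2 :=
      (continuous_path.comp (continuous_fst.comp continuous_fst)).eval continuous_snd
    have h2 : Continuous fun q : (Loop M × Loop M) × unitInterval => q.1.2.path q.2 :=
      (continuous_path.comp (continuous_snd.comp continuous_fst)).eval continuous_snd
    exact v.continuous.comp (h1.prodMk h2)
  exact continuous_of_dominated (bound := fun _ => ‖v‖)
    (fun p => (h.comp (Continuous.prodMk_right p)).aestronglyMeasurable)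
    (fun p => ae_of_all _ fun τ => v.norm_coe_le_norm _) (integrable_const _)
    (ae_of_all _ fun τ => h.comp (Continuous.prodMk_left τ))

end LoopSpace

section Energy

variable {L M : Type*} [MetricSpace M]

instance : Inhabited (SymPot M) := ⟨⟨0, fun _ _ => by simp⟩⟩

/-- The energy of the edge `e` in the configuration `y`, for the pair potential `f`. -/
def SymPot.edgeEnergy (f : SymPot M) (e : Sym2 L) (y : L → Loop M) : ℝ :=
  Sym2.lift ⟨fun i j => pathV f.val (y i) (y j), fun i j =>
    integral_congr_ae (ae_of_all _ fun τ => f.2 ((y i).path τ) ((y j).path τ))⟩ e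

theorem SymPot.edgeEnergy_mk (f : SymPot M) (i j : L) (y : L → Loop M) :
    f.edgeEnergy s(i, j) y = pathV f.val (y i) (y j) := rfl

theorem SymPot.edgeEnergy_congr (f : SymPot M) (e : Sym2 L) {y y' : L → Loop M}
    (h : ∀ i ∈ e, y i = y' i) : f.edgeEnergy e y = f.edgeEnergy e y' := by
  induction e using Sym2.ind with
  | h i j => simp only [edgeEnergy_mk, h i (by simp), h j (by simp)]

variable [CompactSpace M]

theorem SymPot.abs_edgeEnergy_le (f : SymPot M) (e : Sym2 L) (y : L → Loop M) :
    |f.edgeEnergy e y| ≤ ‖f.val‖ := by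
  induction e using Sym2.ind with
  | h i j => exact abs_pathV_le f.val (y i) (y j)

theorem SymPot.measurable_edgeEnergy (f : SymPot M) (e : Sym2 L) :
    Measurable (f.edgeEnergy e : (L → Loop M) → ℝ) := by
  induction e using Sym2.ind with
  | h i j =>
    have h : Measurable fun y : L → Loop M => (y i, y j) :=
      (measurable_pi_apply i).prodMk (measurable_pi_apply j)
    exact (measurable_pathV f.val).comp h

/-- The bound on the relative oscillation of the Boltzmann weight of an edge with potential `f`. -/
def SymPot.osc (f : SymPot M) : ℝ≥0∞ := ENNReal.ofReal (1 - Real.exp (-(2 * ‖f.val‖)))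

theorem isEdgeWeight_exp_edgeEnergy (f : Sym2 L → SymPot M) :
    IsEdgeWeight (fun e (y : L → Loop M) => ENNReal.ofReal (Real.exp ((f e).edgeEnergy e y)))
      fun e => (f e).osc where
  measurable e := ((f e).measurable_edgeEnergy e).exp.ennreal_ofReal
  congr e y y' h := by rw [(f e).edgeEnergy_congr e h]
  bounds e := by
    have hb := fun y => abs_le.1 ((f e).abs_edgeEnergy_le e y)
    refine ⟨ENNReal.ofReal (Real.exp (-‖(f e).val‖)), ENNReal.ofReal (Real.exp ‖(f e).val‖),
      ENNReal.ofReal (Real.exp (-(2 * ‖(f e).val‖))), ?_, ENNReal.ofReal_ne_top, ?_, ?_, fun y =>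
        ⟨ENNReal.ofReal_le_ofReal (Real.exp_le_exp.2 (hb y).1),
          ENNReal.ofReal_le_ofReal (Real.exp_le_exp.2 (hb y).2)⟩⟩
    · simpa using Real.exp_pos _
    · rw [← ENNReal.ofReal_mul (Real.exp_pos _).le, ← Real.exp_add]
      exact ENNReal.ofReal_le_ofReal (Real.exp_le_exp.2 (by linarith))
    · rw [SymPot.osc, ← ENNReal.ofReal_add (Real.exp_pos _).le
        (sub_nonneg.2 (Real.exp_le_one_iff.2 (by simp)))]
      simp

end Energy

section EdgePotential

variable {L M : Type*} [MetricSpace M] (G : SimpleGraph L)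

open scoped Classical in
/-- The potential of `ω` on the edge `e`, extended by zero off the edge set. -/
def edgePot (ω : (e : G.edgeSet) → SymPot M) (e : Sym2 L) : SymPot M :=
  if h : e ∈ G.edgeSet then ω ⟨e, h⟩ else default

variable {G}

theorem val_edgePot_of_adj [DecidableRel G.Adj] (ω : (e : G.edgeSet) → SymPot M) {ℓ ℓ' : L}
    (h : G.Adj ℓ ℓ') : (edgePot G ω s(ℓ, ℓ')).val = toPot G ω ℓ ℓ' := by
  rw [edgePot, dif_pos (G.mem_edgeSet.2 h), toPot, dif_pos h]

variable (G) in
/-- The Boltzmann weight of an edge. -/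
def boltzmann (ω : (e : G.edgeSet) → SymPot M) (e : Sym2 L) (y : L → Loop M) : ℝ≥0∞ :=
  ENNReal.ofReal (Real.exp ((edgePot G ω e).edgeEnergy e y))

variable [CompactSpace M]

theorem isEdgeWeight_boltzmann (ω : (e : G.edgeSet) → SymPot M) :
    IsEdgeWeight (boltzmann G ω) fun e => (edgePot G ω e).osc :=
  isEdgeWeight_exp_edgeEnergy (edgePot G ω)

end EdgePotential

section Kernel

variable {L M : Type*} [MetricSpace M] [DecidableEq L] (G : SimpleGraph L) [G.LocallyFinite]

/-- The edges with at least one end in `Λ`. -/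
def edgesTouching (Λ : Finset L) : Finset (Sym2 L) :=
  Λ.biUnion fun ℓ => (G.neighborFinset ℓ).image fun ℓ' => s(ℓ, ℓ')

variable {G}

theorem mem_edgesTouching {Λ : Finset L} {e : Sym2 L} :
    e ∈ edgesTouching G Λ ↔ e ∈ G.edgeSet ∧ ∃ i ∈ e, i ∈ Λ := by
  simp only [edgesTouching, Finset.mem_biUnion, Finset.mem_image, SimpleGraph.mem_neighborFinset]
  constructor
  · rintro ⟨ℓ, hℓ, ℓ', h, rfl⟩
    exact ⟨h, ℓ, by simp, hℓ⟩
  · rintro ⟨he, i, hi, hiΛ⟩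
    obtain ⟨j, rfl⟩ := hi
    exact ⟨i, hiΛ, j, he, rfl⟩

theorem sum_edgesTouching (Λ : Finset L) (F : Sym2 L → ℝ) :
    ∑ e ∈ edgesTouching G Λ, F e
      = ∑ ℓ ∈ Λ, ∑ ℓ' ∈ G.neighborFinset ℓ, (if ℓ' ∈ Λ then 1 / 2 else 1) * F s(ℓ, ℓ') := by
  let n : Sym2 L → ℝ := fun e => ((Λ.filter (· ∈ e)).card : ℝ)
  have hn : ∀ ℓ ∈ Λ, ∀ ℓ', ℓ ≠ ℓ' → (n s(ℓ, ℓ'))⁻¹ = if ℓ' ∈ Λ then 1 / 2 else 1 := by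
    intro ℓ hℓ ℓ' hne
    have : Λ.filter (· ∈ s(ℓ, ℓ')) = if ℓ' ∈ Λ then {ℓ, ℓ'} else {ℓ} := by
      ext i
      split_ifs with h <;> simp only [Finset.mem_filter, Sym2.mem_iff, Finset.mem_insert,
        Finset.mem_singleton] <;> grind
    simp only [n, this]
    split_ifs <;> simp [hne]
  have hS : ∀ e ∈ edgesTouching G Λ, F e = ∑ ℓ ∈ Λ, if ℓ ∈ e then (n e)⁻¹ * F e else 0 := by
    intro e he
    obtain ⟨-, i, hi, hiΛ⟩ := mem_edgesTouching.1 he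
    have : n e ≠ 0 := by
      simp only [n, Nat.cast_ne_zero, Finset.card_ne_zero]
      exact ⟨i, by simp [hi, hiΛ]⟩
    rw [← Finset.sum_filter, Finset.sum_const, nsmul_eq_mul, ← mul_assoc, mul_inv_cancel₀ this,
      one_mul]
  rw [Finset.sum_congr rfl hS, Finset.sum_comm]
  refine Finset.sum_congr rfl fun ℓ hℓ => ?_
  rw [← Finset.sum_filter]
  have himg : (edgesTouching G Λ).filter (ℓ ∈ ·)
      = (G.neighborFinset ℓ).image fun ℓ' => s(ℓ, ℓ') := by
    ext e
    simp only [Finset.mem_filter, mem_edgesTouching, Finset.mem_image,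
      SimpleGraph.mem_neighborFinset]
    constructor
    · rintro ⟨⟨he, -⟩, j, rfl⟩
      exact ⟨j, he, rfl⟩
    · rintro ⟨j, hj, rfl⟩
      exact ⟨⟨hj, ℓ, by simp, hℓ⟩, by simp⟩
  rw [himg, Finset.sum_image fun i _ j _ h => Sym2.congr_right.1 h]
  refine Finset.sum_congr rfl fun ℓ' hℓ' => ?_
  rw [hn ℓ hℓ ℓ' (by simpa using G.ne_of_adj (by simpa using hℓ'))]

variable [DecidableRel G.Adj]

theorem condV_eq_sum_edgeEnergy (ω : (e : G.edgeSet) → SymPot M) (Λ : Finset L)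
    (x : Λ → Loop M) (y : L → Loop M) :
    condV G (toPot G ω) Λ x y
      = ∑ e ∈ edgesTouching G Λ, (edgePot G ω e).edgeEnergy e (Finset.glue Λ x y) := by
  have hin : ∀ ℓ : Λ, Finset.glue Λ x y ℓ = x ℓ := fun ℓ => by simp [Finset.glue]
  rw [sum_edgesTouching, ← Finset.sum_coe_sort Λ, condV, Finset.mul_sum, ← Finset.sum_add_distrib]
  refine Finset.sum_congr rfl fun ℓ _ => ?_
  rw [← Finset.sum_inter_add_sum_sdiff (G.neighborFinset ℓ) Λ]
  congr 1
  · have hfil : G.neighborFinset ℓ ∩ Λ = Λ.filter (G.Adj ℓ) := by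
      ext
      simp [and_comm]
    rw [hfil, Finset.sum_filter, ← Finset.sum_coe_sort Λ, Finset.mul_sum]
    refine Finset.sum_congr rfl fun ℓ' _ => ?_
    split_ifs with h h'
    · rw [SymPot.edgeEnergy_mk, val_edgePot_of_adj ω h, hin, hin]
    · exact absurd ℓ'.2 h'
    · simp
  · refine Finset.sum_congr rfl fun ℓ' h => ?_
    obtain ⟨h1, h2⟩ := Finset.mem_sdiff.1 h
    rw [if_neg h2, one_mul, SymPot.edgeEnergy_mk, val_edgePot_of_adj ω (by simpa using h1), hin]
    simp [Finset.glue, h2]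

variable [CompactSpace M] {χ : L → Measure (Loop M)} (ω : (e : G.edgeSet) → SymPot M)

theorem lintegral_gibbsKernel [Countable L] (Λ : Finset L) (y : L → Loop M)
    {g : (L → Loop M) → ℝ≥0∞} (hg : Measurable g) :
    ∫⁻ u, g u ∂(gibbsKernel G χ (toPot G ω) Λ y)
      = condAvg χ (boltzmann G ω) Λ (edgesTouching G Λ) g y := by
  have hexp : ∀ x : Λ → Loop M, ENNReal.ofReal (Real.exp (condV G (toPot G ω) Λ x y))
      = ∏ e ∈ edgesTouching G Λ, boltzmann G ω e (Function.updateFinset y Λ x) := fun x => by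
    rw [condV_eq_sum_edgeEnergy, Real.exp_sum,
      ENNReal.ofReal_prod_of_nonneg fun _ _ => (Real.exp_pos _).le]
    rfl
  have hglue : Measurable fun x : Λ → Loop M => Finset.glue Λ x y :=
    measurable_updateFinset (x := y) (s := Λ)
  have hw : Measurable fun x : Λ → Loop M =>
      ∏ e ∈ edgesTouching G Λ, boltzmann G ω e (Function.updateFinset y Λ x) :=
    ((isEdgeWeight_boltzmann ω).measurable_prod _).comp measurable_updateFinset
  rw [gibbsKernel, lintegral_smul_measure, lintegral_map hg hglue]
  simp only [hexp]
  have hgg : Measurable fun x : Λ → Loop M => g (Finset.glue Λ x y) := hg.comp hglue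
  rw [lintegral_withDensity_eq_lintegral_mul _ hw hgg, condAvg, ENNReal.div_eq_inv_mul,
    smul_eq_mul]
  congr 2
  · simp [condInt, lmarginal, chiProd]
  · simp only [Pi.mul_apply, mul_comm]
    rfl

/-- If the trails to every finite set have finite total weight, then there is exactly one Gibbs
measure. -/
theorem existsUnique_isGibbs [Countable L] (hχ : ∀ ℓ, IsProbabilityMeasure (χ ℓ))
    (hfin : ∀ Δ : Finset L,
      ∑' v, ∑' n, trailSum G (fun e => (edgePot G ω e).osc) Δ n univ v < ∞) :
    ∃! μ : Measure ((ℓ : L) → Loop M), IsGibbs G χ (toPot G ω) μ := by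
  have hw := isEdgeWeight_boltzmann ω
  have : Nonempty (L → Loop M) := ⟨fun ℓ => (nonempty_of_isProbabilityMeasure (χ ℓ)).some⟩
  have hone : ∀ {s : Set (L → Loop M)}, MeasurableSet s →
      Measurable (s.indicator (1 : (L → Loop M) → ℝ≥0∞)) := fun hs => measurable_one.indicator hs
  have happly : ∀ (Λ : Finset L) (y : L → Loop M) {s : Set (L → Loop M)}, MeasurableSet s →
      gibbsKernel G χ (toPot G ω) Λ y s
        = condAvg χ (boltzmann G ω) Λ (edgesTouching G Λ) (s.indicator 1) y := fun Λ y s hs => by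
    rw [← lintegral_gibbsKernel ω Λ y (hone hs), lintegral_indicator_one hs]
  have hdep : ∀ {Δ : Finset L} {B : Set (Δ → Loop M)},
      DependsOn ((cylinder (α := fun _ => Loop M) Δ B).indicator (1 : (L → Loop M) → ℝ≥0∞))
        (Δ : Set L) := fun {Δ B} u u' h => by
    have hiff : u ∈ cylinder (α := fun _ => Loop M) Δ B ↔ u' ∈ cylinder Δ B := by
      rw [mem_cylinder, mem_cylinder, show Δ.restrict u = Δ.restrict u' from
        funext fun i => h i i.2]
    by_cases hu : u ∈ cylinder (α := fun _ => Loop M) Δ B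
    · rw [indicator_of_mem hu, indicator_of_mem (hiff.1 hu), Pi.one_apply, Pi.one_apply]
    · rw [indicator_of_notMem hu, indicator_of_notMem (mt hiff.2 hu)]
  have hcylm : ∀ {Δ : Finset L} {B : Set (Δ → Loop M)}, MeasurableSet B →
      MeasurableSet (cylinder (α := fun _ => Loop M) Δ B) := fun hB => MeasurableSet.cylinder _ hB
  have hmeas : ∀ Λ, Measurable (gibbsKernel G χ (toPot G ω) Λ) := fun Λ =>
    Measure.measurable_of_measurable_coe _ fun s hs => by
      simp only [happly Λ _ hs]
      exact measurable_condAvg hw (hone hs)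
  refine existsUnique_bind_eq_of_uniform (gibbsKernel G χ (toPot G ω)) (fun Λ y => ⟨?_⟩) hmeas
    (funext fun y => Measure.ext fun s hs => ?_) (fun Λ Λ' y hΛ => Measure.ext fun s hs => ?_)
    (fun Λ Δ => ⟨Δ ∪ (edgesTouching G Λ).biUnion Sym2.toFinset, fun B hB y y' h => ?_⟩)
    fun Δ => ⟨fun Λ => trailBound G (fun e => (edgePot G ω e).osc) Δ univ (↑Λ)ᶜ, ?_,
      fun Λ y y' B hB => ?_⟩
  · rw [happly Λ y .univ, indicator_univ, condAvg,
      ENNReal.div_self (condInt_one_ne_zero hw y) (condInt_one_ne_top hw y)]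
  · rw [happly ∅ y hs, Measure.dirac_apply' _ hs]
    simp [condAvg, condInt, edgesTouching]
  · rw [Measure.bind_apply hs (hmeas Λ).aemeasurable]
    simp only [happly Λ _ hs]
    rw [lintegral_gibbsKernel ω Λ' y (measurable_condAvg hw (hone hs)), happly Λ' y hs,
      ← condAvg_condAvg hw (hone hs) hΛ]
    congr 1
    ext u
    refine (condAvg_of_subset hw (hone hs) (fun e he => ?_) (fun e he he' i hi hiΛ => he' ?_) u).symm
    · obtain ⟨h1, i, hi, hiΛ⟩ := mem_edgesTouching.1 he
      exact mem_edgesTouching.2 ⟨h1, i, hi, hΛ hiΛ⟩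
    · exact mem_edgesTouching.2 ⟨(mem_edgesTouching.1 he).1, i, hi, hiΛ⟩
  · simp only [happly Λ _ (hcylm hB)]
    refine condAvg_congr hw hdep (fun i hi _ => h i ?_) fun e he i hi _ => h i ?_
    · exact Finset.mem_coe.2 (Finset.mem_union_left _ hi)
    · exact Finset.mem_coe.2 (Finset.mem_union_right _
        (Finset.mem_biUnion.2 ⟨e, he, Sym2.mem_toFinset.2 hi⟩))
  · have := ENNReal.tendsto_tsum_compl_atTop_zero (hfin Δ).ne
    refine this.congr fun Λ => ?_
    exact tsum_subtype ((↑Λ : Set L)ᶜ)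
      fun v => ∑' n, trailSum G (fun e => (edgePot G ω e).osc) Δ n univ v
  · rw [happly Λ y (hcylm hB), happly Λ y' (hcylm hB)]
    refine (condAvg_le_add_trailBound hw (hone (hcylm hB)) (indicator_le fun _ _ => le_rfl) hdep
      (fun e he => (mem_edgesTouching.1 (Finset.mem_coe.1 he)).1) (W := (↑Λ)ᶜ) (by simp)
      (y' := y')
      fun i hi hi' => absurd hi' (by simpa using hi)).trans ?_
    gcongr
    exact trailBound_mono (subset_univ _) _

end Kernel

section RandomPotential

variable {L M : Type*} [MetricSpace M] [CompactSpace M]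

instance : BorelSpace (SymPot M) := ⟨rfl⟩

theorem SymPot.measurable_norm_val : Measurable fun f : SymPot M => ‖f.val‖ :=
  have : Continuous (SymPot.val : SymPot M → C(M × M, ℝ)) := continuous_subtype_val
  this.norm.measurable

theorem SymPot.measurable_osc : Measurable (SymPot.osc : SymPot M → ℝ≥0∞) :=
  ((measurable_norm_val.const_mul 2).neg.exp.const_sub 1).ennreal_ofReal

theorem SymPot.lintegral_osc_le {P : Measure (SymPot M)} [IsProbabilityMeasure P] {lam : ℝ}
    {θ : ℝ≥0∞} (hθ : P {f | lam < ‖f.val‖} ≤ θ) :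
    ∫⁻ f, f.osc ∂P ≤ ENNReal.ofReal (2 * lam) + θ := by
  have hm : MeasurableSet {f : SymPot M | lam < ‖f.val‖} :=
    measurableSet_lt measurable_const measurable_norm_val
  have hle : ∀ f : SymPot M, f.osc ≤ ENNReal.ofReal (2 * lam)
      + {f : SymPot M | lam < ‖f.val‖}.indicator 1 f := fun f => by
    by_cases hf : lam < ‖f.val‖
    · rw [indicator_of_mem (s := {f : SymPot M | lam < ‖f.val‖}) hf]
      refine le_add_left (ENNReal.ofReal_le_one.2 ?_)
      linarith [Real.exp_pos (-(2 * ‖f.val‖))]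
    · refine le_add_right (ENNReal.ofReal_le_ofReal ?_)
      linarith [Real.add_one_le_exp (-(2 * ‖f.val‖))]
  calc ∫⁻ f, f.osc ∂P
      ≤ ∫⁻ f, ENNReal.ofReal (2 * lam) + {f : SymPot M | lam < ‖f.val‖}.indicator 1 f ∂P :=
        lintegral_mono hle
    _ = ENNReal.ofReal (2 * lam) + P {f | lam < ‖f.val‖} := by
        rw [lintegral_add_left measurable_const, lintegral_indicator_one hm]
        simp
    _ ≤ ENNReal.ofReal (2 * lam) + θ := by gcongr

/-- A measure on a product whose cylinders have product mass makes the coordinates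
independent, with the factors as marginals. -/
theorem lintegral_prod_of_measure_cylinder {ι E : Type*} [MeasurableSpace E]
    {Q : Measure (ι → E)} {Qe : ι → Measure E} [IsProbabilityMeasure Q]
    [∀ e, IsProbabilityMeasure (Qe e)]
    (h : ∀ (s : Finset ι) (A : ι → Set E), (∀ e, MeasurableSet (A e)) →
      Q {ω | ∀ e ∈ s, ω e ∈ A e} = ∏ e ∈ s, Qe e (A e))
    {f : E → ℝ≥0∞} (hf : Measurable f) (s : Finset ι) :
    ∫⁻ ω, ∏ e ∈ s, f (ω e) ∂Q = ∏ e ∈ s, ∫⁻ x, f x ∂(Qe e) := by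
  have hQ : Q = Measure.infinitePi Qe :=
    Measure.eq_infinitePi _ fun s A hA => by
      rw [← h s A hA]
      rfl
  have hind : ProbabilityTheory.iIndepFun (fun e (ω : ι → E) => ω e) Q := by
    rw [hQ]
    exact ProbabilityTheory.iIndepFun_infinitePi (X := fun _ x => x) fun _ => measurable_id
  have hindf := hind.comp (fun _ => f) fun _ => hf
  refine (ProbabilityTheory.lintegral_prod_eq_prod_lintegral_of_indepFun s
    (fun e (ω : ι → E) => f (ω e)) hindf fun e => hf.comp (measurable_pi_apply e)).trans ?_
  refine Finset.prod_congr rfl fun e _ => ?_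
  rw [← Measure.infinitePi_map_eval Qe e, ← hQ, lintegral_map hf (measurable_pi_apply e)]

theorem ae_existsUnique_isGibbs [Countable L] [DecidableEq L] {G : SimpleGraph L}
    [DecidableRel G.Adj] [G.LocallyFinite] {N : ℕ} (hN : ∀ ℓ, G.degree ℓ ≤ N)
    {χ : L → Measure (Loop M)} (hχ : ∀ ℓ, IsProbabilityMeasure (χ ℓ))
    {Q : Measure ((e : G.edgeSet) → SymPot M)} {Qe : (e : G.edgeSet) → Measure (SymPot M)}
    [IsProbabilityMeasure Q] [∀ e, IsProbabilityMeasure (Qe e)]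
    (hQ : ∀ (s : Finset G.edgeSet) (A : (e : G.edgeSet) → Set (SymPot M)),
      (∀ e, MeasurableSet (A e)) → Q {ω | ∀ e ∈ s, ω e ∈ A e} = ∏ e ∈ s, Qe e (A e))
    {q : ℝ≥0∞} (hq : ∀ e, ∫⁻ f, f.osc ∂(Qe e) ≤ q) (hNq : N * q < 1) :
    ∀ᵐ ω ∂Q, ∃! μ : Measure ((ℓ : L) → Loop M), IsGibbs G χ (toPot G ω) μ := by
  have hmeas : ∀ e, Measurable fun ω : (e : G.edgeSet) → SymPot M => (edgePot G ω e).osc := by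
    intro e
    refine SymPot.measurable_osc.comp ?_
    by_cases he : e ∈ G.edgeSet
    · simpa [edgePot, he] using measurable_pi_apply _
    · simp [edgePot, he]
  have hprod : ∀ P : Finset (Sym2 L), ↑P ⊆ G.edgeSet →
      ∫⁻ ω, ∏ e ∈ P, (edgePot G ω e).osc ∂Q ≤ q ^ P.card := by
    intro P hP
    lift P to Finset G.edgeSet using hP
    have hval : ∀ (ω : (e : G.edgeSet) → SymPot M) (e : G.edgeSet), edgePot G ω e = ω e :=
      fun ω e => dif_pos e.2
    simp only [Finset.prod_image Subtype.val_injective.injOn,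
      Finset.card_image_of_injective _ Subtype.val_injective, hval]
    rw [lintegral_prod_of_measure_cylinder hQ SymPot.measurable_osc]
    exact Finset.prod_le_pow_card _ _ _ fun e _ => hq e
  filter_upwards [ae_all_iff.2 fun Δ : Finset L =>
    ae_tsum_trailSum_lt_top hmeas hprod hN hNq Δ] with ω hω
  exact existsUnique_isGibbs ω hχ hω

end RandomPotential

end Uniqueness

/-- **Theorem 2.**  Let `G` be a countable graph with no isolated vertices and with globally
bounded degree.  Then there exist `λ > 0` and `θ ∈ (0,1)` such that for every probability
measure `Q` on `Ω = ∏_{⟨ℓ,ℓ'⟩∈E} Ω_{ℓℓ'}` of product form `Q = ⊗ Q_{ℓℓ'}` with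
`Q_{ℓℓ'}(‖v_{ℓℓ'}‖ > λ) < θ` for every edge, the set `𝒢(v)` of Euclidean Gibbs measures is a
singleton for `Q`-almost all `v ∈ Ω`. -/
theorem almost_sure_uniqueness_random_potentials
    {L : Type} [Countable L] [DecidableEq L]
    (G : SimpleGraph L) [DecidableRel G.Adj] [G.LocallyFinite]
    (hdeg : ∃ N : ℕ, ∀ ℓ : L, G.degree ℓ ≤ N)
    (hnoiso : ∀ ℓ : L, 0 < G.degree ℓ)
    (M : Type) [MetricSpace M] [CompactSpace M]
    (χ : L → Measure (Loop M)) (hχ : ∀ ℓ, IsProbabilityMeasure (χ ℓ)) :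
    ∃ lam θ : ℝ, 0 < lam ∧ θ ∈ Set.Ioo (0 : ℝ) 1 ∧
      ∀ (Q : Measure ((e : G.edgeSet) → SymPot M))
        (Qe : (e : G.edgeSet) → Measure (SymPot M)),
        IsProbabilityMeasure Q →
        (∀ e, IsProbabilityMeasure (Qe e)) →
        (∀ (s : Finset G.edgeSet) (A : (e : G.edgeSet) → Set (SymPot M)),
            (∀ e, MeasurableSet (A e)) →
            Q {ω | ∀ e ∈ s, ω e ∈ A e} = ∏ e ∈ s, Qe e (A e)) →
        (∀ e : G.edgeSet, Qe e {f | lam < ‖f.val‖} < ENNReal.ofReal θ) →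
        ∀ᵐ ω ∂Q, ∃! μ : Measure ((ℓ : L) → Loop M), IsGibbs G χ (toPot G ω) μ := by
  obtain ⟨N, hN⟩ := hdeg
  have hN0 : (0 : ℝ) < 6 * (N + 1) := by positivity
  refine ⟨1 / (6 * (N + 1)), 1 / (6 * (N + 1)), by positivity, ⟨by positivity, ?_⟩, ?_⟩
  · rw [div_lt_one hN0]
    linarith [(Nat.cast_nonneg N : (0 : ℝ) ≤ N)]
  · intro Q Qe hQ hQe hprod hlam
    refine ae_existsUnique_isGibbs hN hχ hprod
      (fun e => SymPot.lintegral_osc_le (hlam e).le) ?_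
    rw [← ENNReal.ofReal_add (by positivity) (by positivity), ← ENNReal.ofReal_natCast,
      ← ENNReal.ofReal_mul (Nat.cast_nonneg N), ENNReal.ofReal_lt_one]
    field_simp
    linarith [(Nat.cast_nonneg N : (0 : ℝ) ≤ N)]

end
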